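/- arXiv:2008.11268 — 4 statements merged into one kernel-verified Lean document; each statement's English description precedes it below -/
import Mathlib

section
/- Every minimal vanishing sorou of weight strictly less than 21 has height 1; every minimal vanishing sorou of weight 21 has height at most 2; and there exists a minimal vanishing sorou of weight 21 and height exactly 2. -/
open Complex

noncomputable def nu (n : ℕ) : ℂ := Complex.exp (2 * Real.pi * Complex.I / n)

def IsRootOfUnity (z : ℂ) : Prop := ∃ n : ℕ, 0 < n ∧ z ^ n = 1

def IsSorou (h : Multiset ℂ) : Prop := h ≠ 0 ∧ ∀ z ∈ h, IsRootOfUnity z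

noncomputable def rootOrder (z : ℂ) : ℕ := sInf {d : ℕ | 0 < d ∧ z ^ d = 1}

noncomputable def sorouOrder (h : Multiset ℂ) : ℕ := (h.map rootOrder).lcm

noncomputable def relOrder (h : Multiset ℂ) : ℕ :=
  (h.bind fun a => h.map fun b => rootOrder (a / b)).lcm

def IsMinVanishing (h : Multiset ℂ) : Prop :=
  h.sum = 0 ∧ ∀ g : Multiset ℂ, g ≤ h → g ≠ 0 → g ≠ h → g.sum ≠ 0

open IntermediateField in
lemma totient_le_mul_natDegree_minpoly {m N : ℕ} (hm : 0 < m) (hN : 0 < N) {η ξ ζ : ℂ}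
    (hη : IsPrimitiveRoot η m) (hξ : IsPrimitiveRoot ξ N) (hζ : IsIntegral ℚ⟮η⟯ ζ)
    (hmem : ξ ∈ ℚ⟮η⟯⟮ζ⟯) :
    N.totient ≤ m.totient * (minpoly ℚ⟮η⟯ ζ).natDegree := by
  have finrank_adjoin : ∀ {k : ℕ} {θ : ℂ}, 0 < k → IsPrimitiveRoot θ k →
      Module.finrank ℚ ℚ⟮θ⟯ = k.totient := by
    intro k θ hk hθ
    rw [adjoin.finrank ((hθ.isIntegral hk).tower_top), ← Polynomial.cyclotomic_eq_minpoly_rat hθ hk,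
      Polynomial.natDegree_cyclotomic]
  have : FiniteDimensional ℚ ℚ⟮η⟯ := adjoin.finiteDimensional ((hη.isIntegral hm).tower_top)
  have : FiniteDimensional ℚ⟮η⟯ ℚ⟮η⟯⟮ζ⟯ := adjoin.finiteDimensional hζ
  have : FiniteDimensional ℚ ℚ⟮η⟯⟮ζ⟯ := FiniteDimensional.trans ℚ ℚ⟮η⟯ ℚ⟮η⟯⟮ζ⟯
  have hle : ℚ⟮ξ⟯ ≤ ℚ⟮η⟯⟮ζ⟯.restrictScalars ℚ := by
    rw [adjoin_simple_le_iff]; exact hmem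
  have : FiniteDimensional ℚ (ℚ⟮η⟯⟮ζ⟯.restrictScalars ℚ) := ‹FiniteDimensional ℚ ℚ⟮η⟯⟮ζ⟯›
  have h1 := finrank_le_of_le_right hle
  rw [finrank_adjoin hN hξ] at h1
  refine h1.trans_eq ?_
  rw [← finrank_adjoin hm hη, ← adjoin.finrank hζ]
  exact (Module.finrank_mul_finrank ℚ ℚ⟮η⟯ ℚ⟮η⟯⟮ζ⟯).symm

lemma eq_zero_of_sum_pow_mul_eq_zero {K : IntermediateField ℚ ℂ} {ζ : ℂ} {d : ℕ}
    (hd : d ≤ (minpoly K ζ).natDegree) {x : ℕ → ℂ} (hx : ∀ j < d, x j ∈ K)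
    (h0 : ∑ j ∈ Finset.range d, ζ ^ j * x j = 0) : ∀ j < d, x j = 0 := by
  have hli := (linearIndependent_pow (K := K) ζ).comp (Fin.castLE hd) (Fin.castLE_injective hd)
  rw [Fintype.linearIndependent_iff] at hli
  intro j hj
  have := hli (fun i => ⟨x i, hx i i.2⟩) (by
    rw [← h0, Finset.sum_range]
    refine Finset.sum_congr rfl fun i _ => ?_
    rw [Algebra.smul_def, mul_comm]
    rfl) ⟨j, hj⟩
  exact congrArg Subtype.val this

lemma eq_zero_of_sum_pow_mul_eq_zero_of_dvd {p m : ℕ} (hp : p.Prime) (hm : 0 < m) (hpm : p ∣ m)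
    {η ζ : ℂ} (hη : IsPrimitiveRoot η m) (hζ : IsPrimitiveRoot ζ (p * m)) {x : ℕ → ℂ}
    (hx : ∀ j < p, x j ∈ IntermediateField.adjoin ℚ {η})
    (h0 : ∑ j ∈ Finset.range p, ζ ^ j * x j = 0) : ∀ j < p, x j = 0 := by
  have hN : 0 < p * m := Nat.mul_pos hp.pos hm
  refine eq_zero_of_sum_pow_mul_eq_zero ?_ hx h0
  have := totient_le_mul_natDegree_minpoly hm hN hη hζ (hζ.isIntegral hN).tower_top
    (IntermediateField.mem_adjoin_simple_self _ ζ)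
  rw [Nat.totient_mul_of_prime_of_dvd hp hpm, mul_comm] at this
  exact Nat.le_of_mul_le_mul_left this (Nat.totient_pos.2 hm)

lemma eq_of_sum_pow_mul_eq_zero_of_coprime {p m : ℕ} (hp : p.Prime) (hm : 0 < m)
    (hpm : p.Coprime m) {η ζ : ℂ} (hη : IsPrimitiveRoot η m) (hζ : IsPrimitiveRoot ζ p) {x : ℕ → ℂ}
    (hx : ∀ j < p, x j ∈ IntermediateField.adjoin ℚ {η})
    (h0 : ∑ j ∈ Finset.range p, ζ ^ j * x j = 0) : ∀ j < p, x j = x 0 := by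
  have hN : 0 < p * m := Nat.mul_pos hp.pos hm
  have hprod : IsPrimitiveRoot (ζ * η) (p * m) := by
    have h := (Commute.all ζ η).orderOf_mul_eq_mul_orderOf_of_coprime
      (by rwa [← hζ.eq_orderOf, ← hη.eq_orderOf])
    rw [← hζ.eq_orderOf, ← hη.eq_orderOf] at h
    rw [← h]
    exact IsPrimitiveRoot.orderOf _
  have hdeg : p - 1 ≤ (minpoly (IntermediateField.adjoin ℚ {η}) ζ).natDegree := by
    have := totient_le_mul_natDegree_minpoly hm hN hη hprod (hζ.isIntegral hp.pos).tower_top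
      (mul_mem (IntermediateField.mem_adjoin_simple_self _ ζ)
        (IntermediateField.algebraMap_mem _ (⟨η, IntermediateField.mem_adjoin_simple_self _ η⟩ :
          IntermediateField.adjoin ℚ {η})))
    rw [Nat.totient_mul hpm, Nat.totient_prime hp, mul_comm] at this
    exact Nat.le_of_mul_le_mul_left this (Nat.totient_pos.2 hm)
  obtain ⟨q, rfl⟩ : ∃ q, p = q + 1 := ⟨p - 1, by have := hp.pos; omega⟩
  have key : ∀ j < q, x j - x q = 0 := by
    refine eq_zero_of_sum_pow_mul_eq_zero hdeg
      (fun j hj => sub_mem (hx j (by omega)) (hx q (by omega))) ?_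
    have hg := hζ.geom_sum_eq_zero hp.one_lt
    rw [Finset.sum_range_succ] at hg h0
    simp only [Nat.add_sub_cancel, mul_sub, Finset.sum_sub_distrib, ← Finset.sum_mul]
    linear_combination h0 - x q * hg
  have key' : ∀ j < q + 1, x j = x q := fun j hj => by
    rcases Nat.lt_succ_iff_lt_or_eq.1 hj with h | rfl
    · exact sub_eq_zero.1 (key j h)
    · rfl
  intro j hj
  rw [key' j hj, key' 0 hp.pos]

/-- A multiset without nonempty vanishing sub-multisets. -/
def ZeroSumFree (f : Multiset ℂ) : Prop := ∀ g ≤ f, g.sum = 0 → g = 0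

lemma ZeroSumFree.mono {f g : Multiset ℂ} (hf : ZeroSumFree f) (h : g ≤ f) : ZeroSumFree g :=
  fun k hk => hf k (hk.trans h)

lemma ZeroSumFree.eq_of_le {f g : Multiset ℂ} (hf : ZeroSumFree f) (h : g ≤ f)
    (hs : g.sum = f.sum) : g = f := by
  obtain ⟨k, rfl⟩ := Multiset.le_iff_exists_add.1 h
  have : k = 0 := hf k (Multiset.le_add_left _ _) (by simpa using hs)
  simp [this]

lemma IsMinVanishing.eq_of_le {h g : Multiset ℂ} (hh : IsMinVanishing h) (hg : g ≤ h)
    (hs : g.sum = 0) : g = 0 ∨ g = h := by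
  by_contra! H
  exact hh.2 g hg H.1 H.2 hs

lemma exists_add_of_le_add {g s t : Multiset ℂ} (h : g ≤ s + t) :
    ∃ g₁ ≤ s, ∃ g₂ ≤ t, g = g₁ + g₂ := by
  refine ⟨g ∩ s, Multiset.inter_le_right, g - s, ?_, ?_⟩
  · rwa [tsub_le_iff_left]
  · rw [add_comm, Multiset.sub_add_inter]

lemma exists_sum_of_le_sum {p : ℕ} {F : ℕ → Multiset ℂ} {g : Multiset ℂ}
    (h : g ≤ ∑ j ∈ Finset.range p, F j) :
    ∃ G : ℕ → Multiset ℂ, (∀ j, G j ≤ F j) ∧ g = ∑ j ∈ Finset.range p, G j := by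
  induction p generalizing g with
  | zero => exact ⟨fun _ => 0, fun _ => Multiset.zero_le _, by simpa using h⟩
  | succ p ih =>
    rw [Finset.sum_range_succ] at h
    obtain ⟨g₁, h₁, g₂, h₂, rfl⟩ := exists_add_of_le_add h
    obtain ⟨G, hG, rfl⟩ := ih h₁
    refine ⟨Function.update G p g₂, fun j => ?_, ?_⟩
    · rcases eq_or_ne j p with rfl | hj
      · simpa using h₂
      · simpa [hj] using hG j
    · rw [Finset.sum_range_succ, Function.update_self]
      congr 1
      refine Finset.sum_congr rfl fun j hj => ?_
      rw [Function.update_of_ne (Finset.mem_range.1 hj).ne]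

/-- The multiset `∑ ζ ^ j f_j`, rotated by `c`. -/
noncomputable def assemble (p : ℕ) (ζ c : ℂ) (f : ℕ → Multiset ℂ) : Multiset ℂ :=
  ∑ j ∈ Finset.range p, (f j).map (c * ζ ^ j * ·)

lemma sum_assemble (p : ℕ) (ζ c : ℂ) (f : ℕ → Multiset ℂ) :
    (assemble p ζ c f).sum = c * ∑ j ∈ Finset.range p, ζ ^ j * (f j).sum := by
  rw [assemble, Finset.mul_sum, ← Multiset.coe_sumAddMonoidHom, map_sum]
  refine Finset.sum_congr rfl fun j _ => ?_
  rw [Multiset.coe_sumAddMonoidHom, Multiset.sum_map_mul_left, Multiset.map_id', mul_assoc]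

lemma card_assemble (p : ℕ) (ζ c : ℂ) (f : ℕ → Multiset ℂ) :
    Multiset.card (assemble p ζ c f) = ∑ j ∈ Finset.range p, Multiset.card (f j) := by
  simp [assemble]

lemma assemble_mono {p : ℕ} (ζ c : ℂ) {f g : ℕ → Multiset ℂ} (h : ∀ j < p, g j ≤ f j) :
    assemble p ζ c g ≤ assemble p ζ c f :=
  Finset.sum_le_sum fun j hj => Multiset.map_le_map (h j (Finset.mem_range.1 hj))

lemma mem_assemble {p : ℕ} {ζ c z : ℂ} {f : ℕ → Multiset ℂ} :
    z ∈ assemble p ζ c f ↔ ∃ j < p, ∃ u ∈ f j, c * ζ ^ j * u = z := by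
  simp [assemble, Multiset.mem_sum]

lemma exists_eq_assemble {p m : ℕ} (hp : 0 < p) {ζ : ℂ} (hζ : IsPrimitiveRoot (ζ ^ m) p)
    (hζ0 : ζ ≠ 0) (h : Multiset ℂ) (hh : ∀ z ∈ h, z ^ (p * m) = 1) :
    ∃ f : ℕ → Multiset ℂ, h = assemble p ζ 1 f ∧ ∀ j < p, ∀ u ∈ f j, u ^ m = 1 := by
  induction h using Multiset.induction with
  | empty => exact ⟨fun _ => 0, by simp [assemble], by simp⟩
  | cons z h ih =>
    obtain ⟨f, rfl, hf⟩ := ih fun w hw => hh w (Multiset.mem_cons_of_mem hw)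
    have hz := hh z (Multiset.mem_cons_self _ _)
    have : NeZero p := ⟨hp.ne'⟩
    obtain ⟨i, hi, hzi⟩ := hζ.eq_pow_of_pow_eq_one (ξ := z ^ m) (by rw [← pow_mul, mul_comm, hz])
    refine ⟨Function.update f i (z / ζ ^ i ::ₘ f i), ?_, fun j hj u hu => ?_⟩
    · rw [assemble, assemble, ← Finset.add_sum_erase _ _ (Finset.mem_range.2 hi),
        ← Finset.add_sum_erase _ _ (Finset.mem_range.2 hi), Function.update_self,
        Multiset.map_cons, Multiset.cons_add, one_mul, mul_div_cancel₀ _ (pow_ne_zero _ hζ0)]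
      congr 2
      refine Finset.sum_congr rfl fun j hj => ?_
      rw [Function.update_of_ne (Finset.ne_of_mem_erase hj)]
    · rcases eq_or_ne j i with rfl | hji
      · rw [Function.update_self, Multiset.mem_cons] at hu
        rcases hu with rfl | hu
        · rw [div_pow, ← hzi, ← pow_mul, ← pow_mul, mul_comm, div_self]
          exact pow_ne_zero _ hζ0
        · exact hf j hj u hu
      · rw [Function.update_of_ne hji] at hu
        exact hf j hj u hu

lemma count_assemble_le {p m : ℕ} {ζ c : ℂ} (hζ : IsPrimitiveRoot (ζ ^ m) p)
    (hζ0 : ζ ≠ 0) (hc : c ≠ 0) {f : ℕ → Multiset ℂ} (hf : ∀ j < p, ∀ u ∈ f j, u ^ m = 1) {k : ℕ}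
    (hk : ∀ j < p, ∀ u, (f j).count u ≤ k) (z : ℂ) : (assemble p ζ c f).count z ≤ k := by
  by_cases hz : z ∈ assemble p ζ c f
  · obtain ⟨i, hi, u, hu, rfl⟩ := mem_assemble.1 hz
    rw [assemble, Multiset.count_sum', Finset.sum_eq_single_of_mem i (Finset.mem_range.2 hi)]
    · rw [Multiset.count_map_eq_count' _ _
        (mul_right_injective₀ (mul_ne_zero hc (pow_ne_zero _ hζ0)))]
      exact hk i hi u
    · intro j hj hji
      rw [Finset.mem_range] at hj
      rw [Multiset.count_eq_zero, Multiset.mem_map]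
      rintro ⟨v, hv, hvu⟩
      refine hji (hζ.pow_inj hj hi ?_)
      have h1 : ζ ^ j * v = ζ ^ i * u := by
        rw [mul_assoc, mul_assoc] at hvu
        exact mul_left_cancel₀ hc hvu
      have h2 := congrArg (· ^ m) h1
      simp only [mul_pow, hf j hj v hv, hf i hi u hu, mul_one] at h2
      rw [← pow_mul, mul_comm, pow_mul, h2, ← pow_mul, mul_comm, pow_mul]
  · rw [Multiset.count_eq_zero_of_notMem hz]
    exact Nat.zero_le _

/-- A decomposition of a minimal vanishing sorou along the powers of a `p`-th root of unity. -/
structure PrimeLevel (h : Multiset ℂ) (p m : ℕ) (ζ c α : ℂ) (f : ℕ → Multiset ℂ) : Prop where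
  prime : p.Prime
  coprime : p.Coprime m
  prim : IsPrimitiveRoot ζ p
  c_ne : c ≠ 0
  eq : h = assemble p ζ c f
  root : ∀ j < p, ∀ u ∈ f j, u ^ m = 1
  sum : ∀ j < p, (f j).sum = α
  ne_zero : α ≠ 0
  zsf : ∀ j < p, ZeroSumFree (f j)
  split : ∀ β ≠ 0, (∀ j < p, ∃ g ≤ f j, g.sum = β) → β = α

lemma sum_mem_adjoin {m : ℕ} [NeZero m] {η : ℂ} (hη : IsPrimitiveRoot η m) {f : Multiset ℂ}
    (hf : ∀ u ∈ f, u ^ m = 1) : f.sum ∈ IntermediateField.adjoin ℚ {η} := by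
  refine multiset_sum_mem _ fun u hu => ?_
  obtain ⟨i, _, rfl⟩ := hη.eq_pow_of_pow_eq_one (hf u hu)
  exact pow_mem (IntermediateField.mem_adjoin_simple_self _ _) i

/-- If a minimal vanishing sorou decomposes into vanishing parts, only one part is nonempty. -/
lemma IsMinVanishing.eq_single {p : ℕ} {ζ c : ℂ} {f : ℕ → Multiset ℂ}
    (hh : IsMinVanishing (assemble p ζ c f)) (h0 : assemble p ζ c f ≠ 0)
    (hf : ∀ j < p, (f j).sum = 0) :
    ∃ j < p, assemble p ζ c f = (f j).map (c * ζ ^ j * ·) := by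
  obtain ⟨z, hz⟩ := Multiset.exists_mem_of_ne_zero h0
  obtain ⟨j, hj, u, hu, -⟩ := mem_assemble.1 hz
  refine ⟨j, hj, ?_⟩
  rcases hh.eq_of_le (g := (f j).map (c * ζ ^ j * ·))
    (Finset.single_le_sum (f := fun j => (f j).map (c * ζ ^ j * ·))
      (fun _ _ => Multiset.zero_le _) (Finset.mem_range.2 hj))
    (by rw [Multiset.sum_map_mul_left, Multiset.map_id', hf j hj, mul_zero]) with h | h
  · rw [Multiset.map_eq_zero] at h
    simp [h] at hu
  · exact h.symm

lemma exists_primeLevel {h : Multiset ℂ} (h0 : h ≠ 0) (hh : IsMinVanishing h) {M : ℕ} (hM : 0 < M)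
    (hroot : ∀ z ∈ h, z ^ M = 1) :
    ∃ p m ζ c α f, p * m ∣ M ∧ Squarefree m ∧ (∀ q : ℕ, q.Prime → q ∣ m → q < p) ∧
      PrimeLevel h p m ζ c α f := by
  classical
  have hex : ∃ N : ℕ, N ∣ M ∧ ∃ c : ℂ, c ≠ 0 ∧ ∀ z ∈ h, (c * z) ^ N = 1 :=
    ⟨M, dvd_rfl, 1, one_ne_zero, by simpa using hroot⟩
  set N := Nat.find hex with hN
  obtain ⟨hNM, c, hc, hcz⟩ := Nat.find_spec hex
  rw [← hN] at hNM hcz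
  have hmin : ∀ m < N, m ∣ M → ∀ d : ℂ, d ≠ 0 → ∃ z ∈ h, (d * z) ^ m ≠ 1 := by
    intro m hm hmM d hd
    by_contra! H
    exact Nat.find_min hex hm ⟨hmM, d, hd, H⟩
  have hNpos : 0 < N := Nat.pos_of_dvd_of_pos hNM hM
  set h' := h.map (c * ·) with hh'
  have hh'root : ∀ z ∈ h', z ^ N = 1 := by simpa [hh'] using hcz
  have hback : h = h'.map (c⁻¹ * ·) := by simp [hh', hc]
  have not_single : ∀ {m : ℕ} {d : ℂ} {g : Multiset ℂ}, m < N → m ∣ M → d ≠ 0 →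
      (∀ u ∈ g, u ^ m = 1) → h ≠ g.map (d * ·) := by
    rintro m d g hmN hmM hd hg rfl
    obtain ⟨z, hz, hzm⟩ := hmin m hmN hmM d⁻¹ (inv_ne_zero hd)
    obtain ⟨u, hu, rfl⟩ := Multiset.mem_map.1 hz
    rw [inv_mul_cancel_left₀ hd] at hzm
    exact hzm (hg u hu)
  have decomp : ∀ {p m : ℕ} {ζ : ℂ}, p.Prime → N = p * m → IsPrimitiveRoot (ζ ^ m) p → ζ ≠ 0 →
      ∃ f : ℕ → Multiset ℂ, h = assemble p ζ c⁻¹ f ∧ (∀ j < p, ∀ u ∈ f j, u ^ m = 1) ∧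
        ∑ j ∈ Finset.range p, ζ ^ j * (f j).sum = 0 := by
    intro p m ζ hp hNpm hζ hζ0
    obtain ⟨f, hf, hfm⟩ := exists_eq_assemble hp.pos hζ hζ0 h' (hNpm ▸ hh'root)
    have hhf : h = assemble p ζ c⁻¹ f := by
      rw [hback, hf, assemble, assemble, ← Multiset.coe_mapAddMonoidHom, map_sum]
      refine Finset.sum_congr rfl fun j _ => ?_
      simp [mul_assoc]
    refine ⟨f, hhf, hfm, ?_⟩
    have := hh.1
    rw [hhf, sum_assemble] at this
    exact (mul_eq_zero.1 this).resolve_left (inv_ne_zero hc)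
  have no_vanishing : ∀ {p m : ℕ} {ζ : ℂ} {f : ℕ → Multiset ℂ}, p.Prime → N = p * m → ζ ≠ 0 →
      h = assemble p ζ c⁻¹ f → (∀ j < p, ∀ u ∈ f j, u ^ m = 1) →
      ¬ ∀ j < p, (f j).sum = 0 := by
    intro p m ζ f hp hNpm hζ0 hhf hfm H
    obtain ⟨j, hj, hjeq⟩ := IsMinVanishing.eq_single (hhf ▸ hh) (hhf ▸ h0) H
    refine not_single (m := m) ?_ ((Dvd.intro_left p hNpm.symm).trans hNM)
      (mul_ne_zero (inv_ne_zero hc) (pow_ne_zero j hζ0)) (hfm j hj) (hhf.trans hjeq)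
    rw [hNpm]
    exact lt_mul_left (Nat.pos_of_mul_pos_left (hNpm ▸ hNpos)) hp.one_lt
  have coprime_of : ∀ {p m : ℕ}, p.Prime → N = p * m → p.Coprime m := by
    intro p m hp hNpm
    have hm : 0 < m := Nat.pos_of_mul_pos_left (hNpm ▸ hNpos)
    by_contra hcop
    rw [hp.coprime_iff_not_dvd, not_not] at hcop
    have hζ := Complex.isPrimitiveRoot_exp (p * m) (by rw [← hNpm]; exact hNpos.ne')
    have hη := Complex.isPrimitiveRoot_exp m hm.ne'
    have : NeZero m := ⟨hm.ne'⟩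
    have hζ0 := hζ.ne_zero (by rw [← hNpm]; exact hNpos.ne')
    obtain ⟨f, hhf, hfm, hs⟩ := decomp hp hNpm (hζ.pow (hNpm ▸ hNpos) (mul_comm _ _)) hζ0
    exact no_vanishing hp hNpm hζ0 hhf hfm
      (eq_zero_of_sum_pow_mul_eq_zero_of_dvd hp hm hcop hη hζ
        (fun j hj => sum_mem_adjoin hη (hfm j hj)) hs)
  have hN1 : N ≠ 1 := by
    intro h1
    have : h' = Multiset.replicate (Multiset.card h') 1 :=
      Multiset.eq_replicate.2 ⟨rfl, fun z hz => by simpa [h1] using hh'root z hz⟩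
    have hs : h'.sum = 0 := by
      rw [hh', Multiset.sum_map_mul_left, Multiset.map_id', hh.1, mul_zero]
    rw [this, Multiset.sum_replicate, nsmul_eq_mul, mul_one, Nat.cast_eq_zero, hh',
      Multiset.card_map, Multiset.card_eq_zero] at hs
    exact h0 hs
  have hne : N.primeFactors.Nonempty := Nat.nonempty_primeFactors.2 (by omega)
  set p := N.primeFactors.max' hne with hpdef
  have hpmem : p ∈ N.primeFactors := Finset.max'_mem _ _
  have hp : p.Prime := Nat.prime_of_mem_primeFactors hpmem
  obtain ⟨m, hNpm⟩ := Nat.dvd_of_mem_primeFactors hpmem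
  have hm : 0 < m := Nat.pos_of_mul_pos_left (hNpm ▸ hNpos)
  have hcop := coprime_of hp hNpm
  have hζ := Complex.isPrimitiveRoot_exp p hp.ne_zero
  have hη := Complex.isPrimitiveRoot_exp m hm.ne'
  have : NeZero m := ⟨hm.ne'⟩
  have hζ0 := hζ.ne_zero hp.ne_zero
  obtain ⟨f, hhf, hfm, hs⟩ := decomp hp hNpm (hζ.pow_of_coprime m hcop.symm) hζ0
  have hsum := eq_of_sum_pow_mul_eq_zero_of_coprime hp hm hcop hη hζ
        (fun j hj => sum_mem_adjoin hη (hfm j hj)) hs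
  have hα : (f 0).sum ≠ 0 := fun hα =>
    no_vanishing hp hNpm hζ0 hhf hfm fun j hj => (hsum j hj).trans hα
  have hsplit : ∀ (g : ℕ → Multiset ℂ) (β : ℂ), (∀ j < p, g j ≤ f j) → (∀ j < p, (g j).sum = β) →
      (∀ j < p, g j = 0) ∨ ∀ j < p, g j = f j := by
    intro g β hg hgs
    have hle := assemble_mono (Complex.exp (2 * Real.pi * Complex.I / p)) c⁻¹ hg
    rw [← hhf] at hle
    rcases hh.eq_of_le hle (by
      rw [sum_assemble, Finset.sum_congr rfl fun j hj => by rw [hgs j (Finset.mem_range.1 hj)],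
        ← Finset.sum_mul, hζ.geom_sum_eq_zero hp.one_lt, zero_mul, mul_zero]) with H | H
    · left
      intro j hj
      have H' := congrArg Multiset.card H
      rw [card_assemble, Multiset.card_zero, Finset.sum_eq_zero_iff] at H'
      exact Multiset.card_eq_zero.1 (H' j (Finset.mem_range.2 hj))
    · right
      have H' := congrArg Multiset.card H
      rw [hhf, card_assemble, card_assemble, Finset.sum_eq_sum_iff_of_le
        fun j hj => Multiset.card_le_card (hg j (Finset.mem_range.1 hj))] at H'
      exact fun j hj => Multiset.eq_of_le_of_card_le (hg j hj) (H' j (Finset.mem_range.2 hj)).ge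
  refine ⟨p, m, _, c⁻¹, (f 0).sum, f, hNpm ▸ hNM, ?_, ?_, hp, hcop, hζ, inv_ne_zero hc, hhf, hfm,
    hsum, hα, ?_, ?_⟩
  · rw [Nat.squarefree_iff_prime_squarefree]
    rintro q hq ⟨r, rfl⟩
    have := coprime_of (p := q) (m := p * (q * r)) hq (by rw [hNpm]; ring)
    rw [hq.coprime_iff_not_dvd] at this
    exact this ⟨p * r, by ring⟩
  · intro q hq hqm
    refine lt_of_le_of_ne (Finset.le_max' _ _ (Nat.mem_primeFactors.2
      ⟨hq, hqm.trans (Dvd.intro_left p hNpm.symm), hNpos.ne'⟩)) ?_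
    intro hqp
    exact (hp.coprime_iff_not_dvd.1 hcop) (by rwa [hqp] at hqm)
  · intro j hj g hg hgs
    rcases hsplit (Function.update (fun _ => 0) j g) 0
      (fun i _ => by
        rcases eq_or_ne i j with rfl | hij
        · simpa using hg
        · simp [hij])
      (fun i _ => by
        rcases eq_or_ne i j with rfl | hij
        · simpa using hgs
        · simp [hij]) with H | H
    · simpa using H j hj
    · obtain ⟨i, hi, hij⟩ : ∃ i < p, i ≠ j := by
        have := hp.two_le
        rcases eq_or_ne j 0 with rfl | hj0
        · exact ⟨1, by omega, by omega⟩
        · exact ⟨0, by omega, hj0.symm⟩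
      have := H i hi
      rw [Function.update_of_ne hij] at this
      exact absurd ((hsum i hi).symm.trans (by rw [← this]; simp)) hα
  · intro β hβ H
    choose! g hg hgs using H
    rcases hsplit g β hg hgs with H' | H'
    · exact absurd ((hgs 0 hp.pos).symm.trans (by rw [H' 0 hp.pos]; simp)) hβ
    · rw [← hgs 0 hp.pos, H' 0 hp.pos]

/-- A primitive sixth root of unity. -/
noncomputable def tau : ℂ := ⟨1 / 2, √3 / 2⟩

lemma tau_sq : tau ^ 2 = tau - 1 := by
  have h3 : √3 * √3 = 3 := Real.mul_self_sqrt (by norm_num)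
  apply Complex.ext
  · simp only [tau, sq, Complex.mul_re, Complex.sub_re, Complex.one_re]
    linarith
  · simp only [tau, sq, Complex.mul_im, Complex.sub_im, Complex.one_im]
    ring

lemma tau_cube : tau ^ 3 = -1 := by linear_combination (tau + 1) * tau_sq

lemma one_sub_tau_cube : (1 - tau) ^ 3 = -1 := by linear_combination (2 - tau) * tau_sq

lemma tau_pow_five : tau ^ 5 = 1 - tau := by
  linear_combination (tau ^ 3 + tau ^ 2 - 1) * tau_sq

lemma one_sub_tau_pow_five : (1 - tau) ^ 5 = tau := by
  linear_combination (-tau ^ 3 + 4 * tau ^ 2 - 5 * tau + 1) * tau_sq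

lemma sqrt_three_pos : 0 < √3 := Real.sqrt_pos.2 (by norm_num)

lemma tau_ne_one_sub_tau : tau ≠ 1 - tau := by
  intro h
  have := congrArg Complex.im h
  simp only [tau, Complex.sub_im, Complex.one_im] at this
  linarith [sqrt_three_pos]

lemma tau_ne_zero : tau ≠ 0 := by
  intro h
  simpa [h] using tau_cube

lemma tau_ne_two : tau ≠ 2 := by
  intro h
  have := tau_cube
  rw [h] at this
  norm_num at this

lemma tau_ne_neg_one : tau ≠ -1 := by
  intro h
  have := tau_sq
  rw [h] at this
  norm_num at this

lemma one_sub_tau_ne_zero : 1 - tau ≠ 0 := by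
  intro h
  simpa [h] using one_sub_tau_cube

lemma eq_of_pow_six {u : ℂ} (h : u ^ 6 = 1) :
    u = 1 ∨ u = tau ∨ u = tau - 1 ∨ u = -1 ∨ u = -tau ∨ u = 1 - tau := by
  have : (u - 1) * ((u - tau) * ((u - (tau - 1)) * ((u + 1) * ((u + tau) * (u - (1 - tau)))))) = 0 := by
    have h1 : (u - tau) * (u - (1 - tau)) = u ^ 2 - u + 1 := by linear_combination -tau_sq
    have h2 : (u + tau) * (u - (tau - 1)) = u ^ 2 + u + 1 := by linear_combination -tau_sq
    calc _ = (u - 1) * (u + 1) * ((u - tau) * (u - (1 - tau))) * ((u + tau) * (u - (tau - 1))) := by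
          ring
      _ = u ^ 6 - 1 := by rw [h1, h2]; ring
      _ = 0 := by rw [h, sub_self]
  simp only [mul_eq_zero, sub_eq_zero, add_eq_zero_iff_eq_neg] at this
  tauto

lemma one_mem_or_of_sector {f : Multiset ℂ} (hf : ZeroSumFree f) (h6 : ∀ u ∈ f, u ^ 6 = 1)
    {A B : ℝ} (hA : 0 < A) (hB : 0 ≤ B) (hs : f.sum = A + B * tau) :
    1 ∈ f ∨ (tau ∈ f ∧ 1 - tau ∈ f) := by
  by_contra! H
  obtain ⟨h1, hτ⟩ := H
  have s3 := sqrt_three_pos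
  let φ : ℂ →+ ℝ :=
    { toFun := fun z => √3 * z.re - z.im
      map_zero' := by simp
      map_add' := fun z w => by simp only [Complex.add_re, Complex.add_im]; ring }
  have hφ : ∀ z, φ z = √3 * z.re - z.im := fun _ => rfl
  have hmem : 1 - tau ∈ f := by
    by_contra hn
    have hle : φ f.sum ≤ 0 := by
      rw [map_multiset_sum]
      refine (Multiset.sum_le_card_nsmul _ 0 fun x hx => ?_).trans_eq (smul_zero _)
      obtain ⟨u, hu, rfl⟩ := Multiset.mem_map.1 hx
      rw [hφ]
      rcases eq_of_pow_six (h6 u hu) with rfl | rfl | rfl | rfl | rfl | rfl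
      · exact absurd hu h1
      all_goals first | exact absurd hu hn | (simp [tau] <;> nlinarith)
    rw [hs, hφ] at hle
    simp [tau] at hle
    nlinarith
  have hτf : tau ∉ f := fun h => hτ h hmem
  have hpos : 0 ≤ f.sum.im := by
    rw [hs]
    simp [tau]
    positivity
  obtain ⟨g, rfl⟩ := Multiset.exists_cons_of_mem hmem
  have hτ1 : tau - 1 ∉ g := by
    intro h
    have := hf {1 - tau, tau - 1} (Multiset.cons_le_cons _ (Multiset.singleton_le.2 h)) (by simp)
    simp at this
  have hle : Complex.imAddGroupHom g.sum ≤ 0 := by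
    rw [map_multiset_sum]
    refine (Multiset.sum_le_card_nsmul _ 0 fun x hx => ?_).trans_eq (smul_zero _)
    obtain ⟨u, hu, rfl⟩ := Multiset.mem_map.1 hx
    have hu' := Multiset.mem_cons_of_mem (b := 1 - tau) hu
    rcases eq_of_pow_six (h6 u hu') with rfl | rfl | rfl | rfl | rfl | rfl
    · exact absurd hu' h1
    · exact absurd hu' hτf
    · exact absurd hu hτ1
    all_goals simp [tau] <;> positivity
  rw [Multiset.sum_cons, Complex.add_im] at hpos
  have : (1 - tau).im < 0 := by simp [tau]
  simp only [Complex.coe_imAddGroupHom] at hle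
  linarith

/-- The sub-multisets of `{ρ}` and `{ρ τ, ρ (1 - τ)}` detect the sector of the plane containing
the value of a zero-sum-free multiset of sixth roots of unity. -/
lemma exists_sector_unit {α : ℂ} (hα : α ≠ 0) :
    ∃ ρ : ℂ, ρ ^ 6 = 1 ∧ ∀ f : Multiset ℂ, ZeroSumFree f → (∀ u ∈ f, u ^ 6 = 1) → f.sum = α →
      {ρ} ≤ f ∨ {ρ * tau, ρ * (1 - tau)} ≤ f := by
  have key : ∀ (ρ : ℂ) (A B : ℝ), ρ ^ 6 = 1 → 0 < A → 0 ≤ B → α = ρ * (A + B * tau) →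
      ∃ ρ : ℂ, ρ ^ 6 = 1 ∧ ∀ f : Multiset ℂ, ZeroSumFree f → (∀ u ∈ f, u ^ 6 = 1) → f.sum = α →
        {ρ} ≤ f ∨ {ρ * tau, ρ * (1 - tau)} ≤ f := by
    intro ρ A B hρ hA hB hαρ
    have hρ0 : ρ ≠ 0 := by rintro rfl; simp at hρ
    refine ⟨ρ, hρ, fun f hf h6 hs => ?_⟩
    obtain ⟨g, rfl⟩ : ∃ g : Multiset ℂ, f = g.map (ρ * ·) :=
      ⟨f.map (ρ⁻¹ * ·), by simp [hρ0]⟩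
    have hg : ZeroSumFree g := fun k hk h0 => by
      have := hf (k.map (ρ * ·)) (Multiset.map_le_map hk)
        (by rw [Multiset.sum_map_mul_left, Multiset.map_id', h0, mul_zero])
      simpa using this
    rw [Multiset.sum_map_mul_left, Multiset.map_id', hαρ] at hs
    rcases one_mem_or_of_sector hg
      (fun u hu => by
        have := h6 _ (Multiset.mem_map_of_mem _ hu)
        rwa [mul_pow, hρ, one_mul] at this)
      hA hB (mul_left_cancel₀ hρ0 hs) with h | ⟨h, h'⟩
    · left
      rw [Multiset.singleton_le]
      simpa using Multiset.mem_map_of_mem (ρ * ·) h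
    · right
      refine Multiset.map_le_map (f := (ρ * ·)) (s := {tau, 1 - tau}) ?_
      rw [Multiset.le_iff_subset (by simpa using tau_ne_one_sub_tau)]
      intro x hx
      simp only [Multiset.insert_eq_cons, Multiset.mem_cons, Multiset.mem_singleton] at hx
      rcases hx with rfl | rfl <;> assumption
  have s3 := sqrt_three_pos
  obtain ⟨A, B, hAB⟩ : ∃ A B : ℝ, α = A + B * tau := by
    refine ⟨α.re - α.im / √3, 2 * α.im / √3, Complex.ext ?_ ?_⟩
    · simp [tau]; field_simp; ring
    · simp [tau]; field_simp
  have hne : A ≠ 0 ∨ B ≠ 0 := by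
    by_contra! H
    simp [hAB, H.1, H.2] at hα
  have t6 : tau ^ 6 = 1 := by linear_combination (tau ^ 3 - 1) * tau_cube
  have t26 : (tau ^ 2) ^ 6 = 1 := by rw [← pow_mul, mul_comm, pow_mul, t6, one_pow]
  have case3 : 0 < B → A + B ≤ 0 → α = tau ^ 2 * ((B : ℝ) + (-(A + B) : ℝ) * tau) := fun _ _ => by
    push_cast
    linear_combination hAB + (A * tau + A + B * tau) * tau_sq
  rcases lt_trichotomy A 0 with hA | hA | hA
  · rcases le_or_gt B 0 with hB | hB
    · exact key (-1) (-A) (-B) (by norm_num) (by linarith) (by linarith)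
        (by push_cast; linear_combination hAB)
    · rcases le_or_gt (A + B) 0 with hC | hC
      · exact key (tau ^ 2) B (-(A + B)) t26 hB (by linarith) (case3 hB hC)
      · exact key tau (A + B) (-A) t6 hC (by linarith)
          (by push_cast; linear_combination hAB + A * tau_sq)
  · rcases hne with h | h
    · exact absurd hA h
    rcases lt_or_gt_of_ne h with hB | hB
    · exact key (-tau) (-(A + B)) A (by rw [neg_pow, t6]; norm_num) (by linarith) hA.ge
        (by push_cast; linear_combination hAB + A * tau_sq)
    · exact key tau (A + B) (-A) t6 (by linarith) (by linarith)
          (by push_cast; linear_combination hAB + A * tau_sq)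
  · rcases le_or_gt 0 B with hB | hB
    · exact key 1 A B (by norm_num) hA hB (by linear_combination hAB)
    · rcases lt_or_ge (A + B) 0 with hC | hC
      · exact key (-tau) (-(A + B)) A (by rw [neg_pow, t6]; norm_num) (by linarith) hA.le
          (by push_cast; linear_combination hAB + A * tau_sq)
      · exact key (-tau ^ 2) (-B) (A + B) (by rw [neg_pow, t26]; norm_num) (by linarith) hC
          (by push_cast; linear_combination hAB + (A * tau + A + B * tau) * tau_sq)

lemma PrimeLevel.one_le_card {h : Multiset ℂ} {p m : ℕ} {ζ c α : ℂ} {f : ℕ → Multiset ℂ}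
    (L : PrimeLevel h p m ζ c α f) {j : ℕ} (hj : j < p) : 1 ≤ Multiset.card (f j) := by
  rw [Nat.one_le_iff_ne_zero, Ne, Multiset.card_eq_zero]
  intro h0
  exact L.ne_zero (by rw [← L.sum j hj, h0, Multiset.sum_zero])

lemma PrimeLevel.card_eq {h : Multiset ℂ} {p m : ℕ} {ζ c α : ℂ} {f : ℕ → Multiset ℂ}
    (L : PrimeLevel h p m ζ c α f) :
    Multiset.card h = ∑ j ∈ Finset.range p, Multiset.card (f j) := by
  rw [L.eq, card_assemble]

lemma PrimeLevel.exists_of_mem {h : Multiset ℂ} {p m : ℕ} {ζ c α : ℂ} {f : ℕ → Multiset ℂ}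
    (L : PrimeLevel h p m ζ c α f) {z : ℂ} (hz : z ∈ h) :
    ∃ j < p, ∃ u ∈ f j, c * ζ ^ j * u = z := by
  rwa [L.eq, mem_assemble] at hz

lemma PrimeLevel.count_le {h : Multiset ℂ} {p m : ℕ} {ζ c α : ℂ} {f : ℕ → Multiset ℂ}
    (L : PrimeLevel h p m ζ c α f) {k : ℕ} (hk : ∀ j < p, ∀ u, (f j).count u ≤ k) (z : ℂ) :
    h.count z ≤ k := by
  rw [L.eq]
  exact count_assemble_le (L.prim.pow_of_coprime m L.coprime.symm) (L.prim.ne_zero L.prime.ne_zero)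
    L.c_ne L.root hk z

lemma dvd_of_squarefree_of_primes {m : ℕ} (hm : Squarefree m) {s : Finset ℕ}
    (hs : ∀ q : ℕ, q.Prime → q ∣ m → q ∈ s) : m ∣ ∏ q ∈ s, q := by
  rw [← Nat.prod_primeFactors_of_squarefree hm]
  exact Finset.prod_dvd_prod_of_subset _ _ _ fun q hq =>
    hs q (Nat.prime_of_mem_primeFactors hq) (Nat.dvd_of_mem_primeFactors hq)

lemma pow_eq_one_of_dvd {u : ℂ} {m n : ℕ} (hu : u ^ m = 1) (h : m ∣ n) : u ^ n = 1 := by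
  obtain ⟨k, rfl⟩ := h
  rw [pow_mul, hu, one_pow]

lemma PrimeLevel.parts_of_dvd_six {h : Multiset ℂ} {p m : ℕ} {ζ c α : ℂ} {f : ℕ → Multiset ℂ}
    (L : PrimeLevel h p m ζ c α f) (hm : m ∣ 6) :
    ∀ j < p, f j = {α} ∨ f j = {α * tau, α * (1 - tau)} := by
  obtain ⟨ρ, hρ, H⟩ := exists_sector_unit L.ne_zero
  have H' := fun j hj =>
    H (f j) (L.zsf j hj) (fun u hu => pow_eq_one_of_dvd (L.root j hj u hu) hm) (L.sum j hj)
  have s2 : Multiset.sum {ρ * tau, ρ * (1 - tau)} = ρ := by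
    rw [Multiset.insert_eq_cons, Multiset.sum_cons, Multiset.sum_singleton]
    ring
  have hρα : ρ = α := by
    refine L.split ρ (by rintro rfl; simp at hρ) fun j hj => ?_
    rcases H' j hj with h | h
    · exact ⟨_, h, by simp⟩
    · exact ⟨_, h, s2⟩
  subst hρα
  intro j hj
  rcases H' j hj with h | h
  · exact Or.inl ((L.zsf j hj).eq_of_le h (by rw [L.sum j hj, Multiset.sum_singleton])).symm
  · exact Or.inr ((L.zsf j hj).eq_of_le h (by rw [L.sum j hj, s2])).symm

lemma PrimeLevel.count_le_one_of_dvd_six {h : Multiset ℂ} {p m : ℕ} {ζ c α : ℂ}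
    {f : ℕ → Multiset ℂ} (L : PrimeLevel h p m ζ c α f) (hm : m ∣ 6) (z : ℂ) : h.count z ≤ 1 := by
  refine L.count_le (fun j hj => ?_) z
  rw [← Multiset.nodup_iff_count_le_one]
  rcases L.parts_of_dvd_six hm j hj with h | h
  · rw [h]; exact Multiset.nodup_singleton _
  · rw [h]
    simpa [L.ne_zero] using tau_ne_one_sub_tau

lemma dvd_six_of_primes_lt_five {m p : ℕ} (hm : Squarefree m)
    (hq : ∀ q : ℕ, q.Prime → q ∣ m → q < p) (hp : p ≤ 5) : m ∣ 6 := by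
  refine dvd_of_squarefree_of_primes (s := {2, 3}) hm fun q hqp hqm => ?_
  have := hq q hqp hqm
  have : q < 5 := by omega
  interval_cases q <;> revert hqp <;> decide

lemma dvd_thirty_of_primes_lt_seven {m : ℕ} (hm : Squarefree m)
    (hq : ∀ q : ℕ, q.Prime → q ∣ m → q < 7) : m ∣ 30 := by
  refine dvd_of_squarefree_of_primes (s := {2, 3, 5}) hm fun q hqp hqm => ?_
  have := hq q hqp hqm
  interval_cases q <;> revert hqp <;> decide

/-- The possible ratios `r` of two elements of a minimal vanishing sum of `k` roots of unity of
order dividing `30`. -/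
def RatioBound (k : ℕ) (r : ℂ) : Prop :=
  (k = 2 ∧ r = -1) ∨ (r ^ 3 = 1 ∧ (k = 3 ∨ 6 ≤ k)) ∨
    (r ^ 6 ≠ 1 ∧ ((r ^ 5 = 1 ∧ 5 ≤ k) ∨ (r ^ 15 = -1 ∧ r ^ 5 ≠ -1 ∧ 6 ≤ k) ∨ (r ^ 15 = 1 ∧ 7 ≤ k)))

lemma RatioBound.inv {k : ℕ} {r : ℂ} (h : RatioBound k r) : RatioBound k r⁻¹ := by
  unfold RatioBound at *
  simp only [inv_pow, Ne, inv_eq_iff_eq_inv, inv_neg, inv_one]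
  exact h

lemma RatioBound.bound_of_le {k₁ k₂ k : ℕ} {q₁ q₂ t : ℂ} (h₁ : RatioBound k₁ q₁)
    (h₂ : RatioBound k₂ q₂) (h : RatioBound k t) (ht : t * q₂ = q₁) (hq₁ : q₁ ≠ 1)
    (ht3 : t ^ 3 ≠ 1) (hk : 4 ≤ k) (hk₁ : k₁ ≤ 4) : 15 ≤ k₁ + k₂ + k := by
  have e : ∀ n : ℕ, t ^ n * q₂ ^ n = q₁ ^ n := fun n => by rw [← mul_pow, ht]
  have e3 := e 3
  have e5 := e 5
  have e6 := e 6
  have e15 := e 15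
  have p6 : ∀ r : ℂ, r ^ 6 = (r ^ 3) ^ 2 := fun r => by ring
  have p15 : ∀ r : ℂ, r ^ 15 = (r ^ 5) ^ 3 := fun r => by ring
  have p15' : ∀ r : ℂ, r ^ 15 = (r ^ 3) ^ 5 := fun r => by ring
  have h11 : (-1 : ℂ) ≠ 1 := by norm_num
  rcases h with ⟨rfl, -⟩ | ⟨h, -⟩ | ⟨ht6, T⟩
  · omega
  · exact absurd h ht3
  have hQ : (k₁ = 2 ∧ q₁ = -1) ∨ (k₁ = 3 ∧ q₁ ^ 3 = 1 ∧ q₁ ^ 5 ≠ 1) := by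
    rcases h₁ with h | ⟨h, h'⟩ | ⟨-, h⟩
    · exact Or.inl h
    · refine Or.inr ⟨by omega, h, fun h5 => hq₁ ?_⟩
      calc q₁ = (q₁ ^ 3) ^ 2 * q₁ - (q₁ ^ 3) * (q₁ ^ 3) * q₁ + q₁ := by ring
        _ = q₁ * (q₁ ^ 5) * 1 := by rw [h5, h]; ring
        _ = (q₁ ^ 3) ^ 2 := by ring
        _ = 1 := by rw [h, one_pow]
    · omega
  rcases hQ with ⟨rfl, rfl⟩ | ⟨rfl, hq3, hq5⟩
  · rcases h₂ with ⟨-, rfl⟩ | ⟨h, -⟩ | ⟨-, ⟨h, hk₂⟩ | ⟨h, h', hk₂⟩ | ⟨h, hk₂⟩⟩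
    · exact absurd (by linear_combination -e3) ht3
    · rw [h, mul_one] at e3
      exact absurd (by rw [p6, e3]; norm_num) ht6
    · rw [h] at e5
      norm_num at e5
      rcases T with ⟨T, -⟩ | ⟨-, T, -⟩ | ⟨T, -⟩
      · exact absurd (e5.symm.trans T) h11
      · exact absurd e5 T
      · rw [p15, e5] at T; norm_num at T
    · rw [h] at e15
      norm_num at e15
      rcases T with ⟨T, -⟩ | ⟨T, -, -⟩ | ⟨-, T⟩
      · rw [T] at e5; norm_num at e5; exact absurd e5 h'
      · exact absurd (T.symm.trans e15) h11
      · omega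
    · rw [h] at e15
      norm_num at e15
      rcases T with ⟨T, -⟩ | ⟨-, -, T⟩ | ⟨T, -⟩
      · rw [p15, T] at e15; norm_num at e15
      · omega
      · exact absurd (e15.symm.trans T) h11
  · have hq6 : q₁ ^ 6 = 1 := by rw [p6, hq3, one_pow]
    have hq15 : q₁ ^ 15 = 1 := by rw [p15', hq3, one_pow]
    rw [hq3] at e3
    rw [hq6] at e6
    rw [hq15] at e15
    rcases h₂ with ⟨-, rfl⟩ | ⟨h, -⟩ | ⟨-, ⟨h, hk₂⟩ | ⟨h, h', hk₂⟩ | ⟨h, hk₂⟩⟩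
    · exact absurd (by linear_combination e6) ht6
    · exact absurd (by rwa [h, mul_one] at e3) ht3
    · rw [p15 q₂, h, one_pow, mul_one] at e15
      rw [h, mul_one] at e5
      rcases T with ⟨T, -⟩ | ⟨T, -, -⟩ | ⟨-, T⟩
      · exact absurd (e5.symm.trans T) hq5
      · exact absurd (T.symm.trans e15) h11
      · omega
    · have e15' : t ^ 15 = -1 := by rw [h] at e15; linear_combination -e15
      rcases T with ⟨T, -⟩ | ⟨-, -, T⟩ | ⟨T, -⟩
      · rw [p15, T] at e15'; norm_num at e15'
      · omega
      · exact absurd (e15'.symm.trans T) h11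
    · omega

lemma RatioBound.bound {k₁ k₂ k : ℕ} {q₁ q₂ t : ℂ} (h₁ : RatioBound k₁ q₁)
    (h₂ : RatioBound k₂ q₂) (h : RatioBound k t) (ht : t * q₂ = q₁) (hq₁ : q₁ ≠ 1) (hq₂ : q₂ ≠ 1)
    (ht3 : t ^ 3 ≠ 1) (hk : 4 ≤ k) : 15 ≤ k₁ + k₂ + k := by
  by_cases hk₁ : k₁ ≤ 4
  · exact h₁.bound_of_le h₂ h ht hq₁ ht3 hk hk₁
  by_cases hk₂ : k₂ ≤ 4
  · have ht0 : t ≠ 0 := by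
      rintro rfl
      rcases h with ⟨rfl, -⟩ | ⟨h, -⟩ | ⟨-, h⟩
      · omega
      · exact ht3 h
      · simp at h
    have := h₂.bound_of_le h₁ h.inv (by rw [← ht, inv_mul_cancel_left₀ ht0]) hq₂
      (by rwa [inv_pow, Ne, inv_eq_one]) hk hk₂
    omega
  have : 5 ≤ k := by
    rcases h with ⟨rfl, -⟩ | ⟨h, -⟩ | ⟨-, h⟩
    · omega
    · exact absurd h ht3
    · omega
  omega

lemma ratioBound_of_pow_thirty {x y : ℂ} {g : Multiset ℂ} (hG : IsMinVanishing (x ::ₘ g))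
    (h30 : ∀ z ∈ x ::ₘ g, z ^ 30 = 1) (hy : y ∈ g) :
    y ≠ x ∧ RatioBound (Multiset.card (x ::ₘ g)) (y / x) := by
  obtain ⟨p, m, ζ, c, α, f, hpm, hsq, hlt, L⟩ :=
    exists_primeLevel (Multiset.cons_ne_zero) hG (by norm_num : 0 < 30) h30
  have hp5 : p ∣ 30 := (Dvd.intro _ rfl).trans hpm
  have hp : p = 2 ∨ p = 3 ∨ p = 5 := by
    have h1 := L.prime
    have : p ∈ Nat.primeFactors 30 := Nat.mem_primeFactors.2 ⟨h1, hp5, by norm_num⟩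
    rw [show (30 : ℕ) = 2 * 3 * 5 by norm_num, Nat.primeFactors_mul (by norm_num) (by norm_num),
      Nat.primeFactors_mul (by norm_num) (by norm_num), Nat.prime_two.primeFactors,
      Nat.prime_three.primeFactors, Nat.prime_five.primeFactors] at this
    simpa [or_assoc] using this
  have hm6 : m ∣ 6 := dvd_six_of_primes_lt_five hsq hlt (by omega)
  have hne : y ≠ x := by
    have := Multiset.nodup_iff_count_le_one.2 (L.count_le_one_of_dvd_six hm6)
    rintro rfl
    exact (Multiset.nodup_cons.1 this).1 hy
  refine ⟨hne, ?_⟩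
  have hparts := L.parts_of_dvd_six hm6
  have hcard := L.card_eq
  have hα := L.ne_zero
  have hζ0 := L.prim.ne_zero L.prime.ne_zero
  have hc := L.c_ne
  obtain ⟨i, hi, u, hu, rfl⟩ := L.exists_of_mem (Multiset.mem_cons_self x g)
  obtain ⟨j, hj, v, hv, rfl⟩ := L.exists_of_mem (Multiset.mem_cons_of_mem hy)
  set k := Multiset.card (c * ζ ^ i * u ::ₘ g) with hk
  have hu0 : u ≠ 0 := by
    intro h0
    have := L.root i hi u hu
    rw [h0, zero_pow (by rintro rfl; norm_num at hpm)] at this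
    exact zero_ne_one this
  have hr : c * ζ ^ j * v / (c * ζ ^ i * u) = ζ ^ j / ζ ^ i * (v / u) := by field_simp
  rw [hr]
  by_cases hp3 : p ≤ 3
  · have hm2 : m ∣ 2 := by
      refine dvd_of_squarefree_of_primes (s := {2}) hsq fun q hqp hqm => ?_
      have h1 := hlt q hqp hqm
      have h2 := hqp.two_le
      rw [Finset.mem_singleton]
      omega
    have hsing : ∀ l < p, f l = {α} := by
      intro l hl
      refine (hparts l hl).resolve_right fun h => ?_
      have h1 := pow_eq_one_of_dvd (L.root l hl (α * tau) (by simp [h])) hm2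
      have h2 := pow_eq_one_of_dvd (L.root l hl (α * (1 - tau)) (by simp [h])) hm2
      have h3 : α ^ 2 * (2 * tau - 1) = 0 := by linear_combination h1 - h2
      rcases mul_eq_zero.1 h3 with h4 | h4
      · exact hα (pow_eq_zero_iff (two_ne_zero) |>.1 h4)
      · exact tau_ne_one_sub_tau (by linear_combination h4)
    rw [hsing i hi, Multiset.mem_singleton] at hu
    rw [hsing j hj, Multiset.mem_singleton] at hv
    subst hu hv
    rw [div_self hα, mul_one]
    have hkp : k = p := by
      rw [hcard, Finset.sum_congr rfl fun l hl => by
        rw [hsing l (Finset.mem_range.1 hl), Multiset.card_singleton]]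
      simp
    have hrp : (ζ ^ j / ζ ^ i) ^ p = 1 := by
      rw [div_pow, ← pow_mul, ← pow_mul, mul_comm j, mul_comm i, pow_mul, pow_mul, L.prim.pow_eq_one,
        one_pow, one_pow, div_one]
    rcases hp with rfl | rfl | rfl
    · left
      refine ⟨hkp, (sq_eq_one_iff.1 hrp).resolve_left ?_⟩
      intro h1
      rw [div_eq_one_iff_eq (pow_ne_zero _ hζ0)] at h1
      exact hne (by rw [h1])
    · exact Or.inr (Or.inl ⟨hrp, Or.inl hkp⟩)
    · omega
  obtain rfl : p = 5 := by omega
  have hge : ∀ l < 5, 1 ≤ Multiset.card (f l) := fun l hl => L.one_le_card hl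
  have hk5 : k = ∑ l ∈ Finset.range 5, Multiset.card (f l) := hcard
  have hk1 : ∀ l < 5, 4 + Multiset.card (f l) ≤ k := by
    intro l hl
    rw [hk5, ← Finset.add_sum_erase _ _ (Finset.mem_range.2 hl), add_comm]
    refine Nat.add_le_add_left ((Finset.card_nsmul_le_sum _ _ 1 fun s hs => hge s
      (Finset.mem_range.1 (Finset.mem_of_mem_erase hs))).trans' ?_) _
    simp [Finset.card_erase_of_mem (Finset.mem_range.2 hl)]
  have hk2 : i ≠ j → 3 + Multiset.card (f i) + Multiset.card (f j) ≤ k := by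
    intro hij
    rw [hk5, ← Finset.add_sum_erase _ _ (Finset.mem_range.2 hi), ← Finset.add_sum_erase _ _
      (Finset.mem_erase.2 ⟨hij.symm, Finset.mem_range.2 hj⟩)]
    have : 3 ≤ ∑ s ∈ ((Finset.range 5).erase i).erase j, Multiset.card (f s) := by
      refine (Finset.card_nsmul_le_sum _ _ 1 fun s hs => hge s
        (Finset.mem_range.1 (Finset.mem_of_mem_erase (Finset.mem_of_mem_erase hs)))).trans' ?_
      rw [Finset.card_erase_of_mem (Finset.mem_erase.2 ⟨hij.symm, Finset.mem_range.2 hj⟩),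
        Finset.card_erase_of_mem (Finset.mem_range.2 hi)]
      simp
    omega
  have hshape : ∀ l < 5, ∀ w ∈ f l, w = α ∨
      ((w = α * tau ∨ w = α * (1 - tau)) ∧ Multiset.card (f l) = 2) := by
    intro l hl w hw
    rcases hparts l hl with h | h
    · left; simpa [h] using hw
    · right; rw [h] at hw ⊢; simpa using hw
  have t0 := tau_ne_zero
  have t1 := one_sub_tau_ne_zero
  rcases eq_or_ne i j with rfl | hij
  · rw [div_self (pow_ne_zero _ hζ0), one_mul]
    have huv : v ≠ u := fun h => hne (by rw [h])
    right; left
    rcases hparts i hi with h | h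
    · rw [h, Multiset.mem_singleton] at hu hv
      exact absurd (hv.trans hu.symm) huv
    · have h4 := hk1 i hi
      have h5 : Multiset.card (f i) = 2 := by rw [h]; rfl
      refine ⟨?_, Or.inr (by omega)⟩
      have cub : ∀ w ∈ f i, w ^ 3 = -α ^ 3 := by
        intro w hw
        rw [h, Multiset.insert_eq_cons, Multiset.mem_cons, Multiset.mem_singleton] at hw
        rcases hw with rfl | rfl
        · rw [mul_pow, tau_cube]; ring
        · rw [mul_pow, one_sub_tau_cube]; ring
      rw [div_pow, cub u hu, cub v hv, div_self]
      exact neg_ne_zero.2 (pow_ne_zero _ hα)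
  · have h5 : (ζ ^ j / ζ ^ i) ^ 5 = 1 := by
      rw [div_pow, ← pow_mul, ← pow_mul, mul_comm j, mul_comm i, pow_mul, pow_mul, L.prim.pow_eq_one,
        one_pow, one_pow, div_one]
    have h1 : ζ ^ j / ζ ^ i ≠ 1 := by
      rw [Ne, div_eq_one_iff_eq (pow_ne_zero _ hζ0)]
      exact fun h => hij (L.prim.pow_inj hj hi h).symm
    set θ := ζ ^ j / ζ ^ i with hθ
    have finish : ∀ s : ℂ, s = v / u →
        (s = 1 ∨ (s ^ 3 = -1 ∧ s ^ 5 ≠ -1 ∧ 6 ≤ k) ∨ (s ^ 3 = 1 ∧ 7 ≤ k)) →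
        RatioBound k (θ * (v / u)) := by
      rintro s rfl hs
      have h15 : (θ * (v / u)) ^ 15 = ((v / u) ^ 3) ^ 5 := by
        calc _ = (θ ^ 5) ^ 3 * ((v / u) ^ 3) ^ 5 := by ring
          _ = _ := by rw [h5]; ring
      have h6 : (θ * (v / u)) ^ 6 = θ * ((v / u) ^ 3) ^ 2 := by
        calc _ = (θ ^ 5) * θ * ((v / u) ^ 3) ^ 2 := by ring
          _ = _ := by rw [h5]; ring
      have h5' : (θ * (v / u)) ^ 5 = (v / u) ^ 5 := by rw [mul_pow, h5, one_mul]
      have := hk1 i hi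
      have := hge i hi
      right; right
      rw [h15, h6, h5']
      rcases hs with hs | ⟨hs, hs', h⟩ | ⟨hs, h⟩
      · rw [hs]
        exact ⟨by simpa using h1, Or.inl ⟨by simp, by omega⟩⟩
      · rw [hs]
        exact ⟨by simpa using h1, Or.inr (Or.inl ⟨by norm_num, hs', h⟩)⟩
      · rw [hs]
        exact ⟨by simpa using h1, Or.inr (Or.inr ⟨by norm_num, h⟩)⟩
    have n5 : tau ^ 5 ≠ -1 := by
      rw [tau_pow_five]
      intro h
      exact tau_ne_two (by linear_combination -h)
    have n5' : (1 - tau) ^ 5 ≠ -1 := by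
      rw [one_sub_tau_pow_five]
      exact tau_ne_neg_one
    have := hk2 hij
    have := hge i hi
    have := hge j hj
    have neg_inv_iff : ∀ w : ℂ, w⁻¹ = -1 ↔ w = -1 := fun w => by
      rw [inv_eq_iff_eq_inv, inv_neg, inv_one]
    rcases hshape i hi u hu with hu | ⟨hu, hcu⟩ <;> rcases hshape j hj v hv with hv | ⟨hv, hcv⟩
    · exact finish 1 (by rw [hu, hv, div_self hα]) (Or.inl rfl)
    · rcases hv with hv | hv
      · exact finish tau (by rw [hu, hv, mul_div_cancel_left₀ _ hα])
          (Or.inr (Or.inl ⟨tau_cube, n5, by omega⟩))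
      · exact finish (1 - tau) (by rw [hu, hv, mul_div_cancel_left₀ _ hα])
          (Or.inr (Or.inl ⟨one_sub_tau_cube, n5', by omega⟩))
    · rcases hu with hu | hu
      · exact finish tau⁻¹ (by rw [hu, hv]; field_simp)
          (Or.inr (Or.inl ⟨by rw [inv_pow, tau_cube]; norm_num,
            by rwa [inv_pow, Ne, neg_inv_iff], by omega⟩))
      · exact finish (1 - tau)⁻¹ (by rw [hu, hv]; field_simp)
          (Or.inr (Or.inl ⟨by rw [inv_pow, one_sub_tau_cube]; norm_num,
            by rwa [inv_pow, Ne, neg_inv_iff], by omega⟩))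
    · refine finish _ rfl (Or.inr (Or.inr ⟨?_, by omega⟩))
      have cub : ∀ w : ℂ, w = α * tau ∨ w = α * (1 - tau) → w ^ 3 = -α ^ 3 := by
        rintro w (rfl | rfl)
        · rw [mul_pow, tau_cube]; ring
        · rw [mul_pow, one_sub_tau_cube]; ring
      rw [div_pow, cub u hu, cub v hv, div_self]
      exact neg_ne_zero.2 (pow_ne_zero _ hα)

lemma eq_zero_or_eq_singleton_of_le {g : Multiset ℂ} {a : ℂ} (h : g ≤ {a}) : g = 0 ∨ g = {a} := by
  rcases Nat.le_one_iff_eq_zero_or_eq_one.1 (Multiset.card_le_card h) with h0 | h1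
  · exact Or.inl (Multiset.card_eq_zero.1 h0)
  · exact Or.inr (Multiset.eq_of_le_of_card_le h h1.ge)

lemma isMinVanishing_neg_cons {f : Multiset ℂ} {a : ℂ} (hf : ZeroSumFree f) (hs : f.sum = a) :
    IsMinVanishing (-a ::ₘ f) := by
  refine ⟨by rw [Multiset.sum_cons, hs, neg_add_cancel], fun g hg h0 h1 hg0 => ?_⟩
  rw [← Multiset.singleton_add] at hg
  obtain ⟨g₁, hg₁, g₂, hg₂, rfl⟩ := exists_add_of_le_add hg
  rw [Multiset.sum_add] at hg0
  rcases eq_zero_or_eq_singleton_of_le hg₁ with rfl | rfl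
  · rw [Multiset.sum_zero, zero_add] at hg0
    exact h0 (by rw [hf g₂ hg₂ hg0, add_zero])
  · rw [Multiset.sum_singleton] at hg0
    exact h1 (by rw [hf.eq_of_le hg₂ (by rw [hs]; linear_combination hg0), Multiset.singleton_add])

lemma isMinVanishing_neg_pair {f : Multiset ℂ} {a b : ℂ} (hf : ZeroSumFree f)
    (hs : f.sum = a + b) (hsub : ∀ g ≤ f, g.sum ≠ a) :
    IsMinVanishing (-a ::ₘ -b ::ₘ f) := by
  refine ⟨by rw [Multiset.sum_cons, Multiset.sum_cons, hs]; ring, fun g hg h0 h1 hg0 => ?_⟩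
  rw [← Multiset.singleton_add, ← Multiset.singleton_add] at hg
  obtain ⟨g₁, hg₁, g', hg', rfl⟩ := exists_add_of_le_add hg
  obtain ⟨g₂, hg₂, g₃, hg₃, rfl⟩ := exists_add_of_le_add hg'
  rw [Multiset.sum_add, Multiset.sum_add] at hg0
  rcases eq_zero_or_eq_singleton_of_le hg₁ with rfl | rfl <;>
  rcases eq_zero_or_eq_singleton_of_le hg₂ with rfl | rfl <;>
  simp only [Multiset.sum_zero, Multiset.sum_singleton] at hg0
  · exact h0 (by rw [hf g₃ hg₃ (by linear_combination hg0)]; rfl)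
  · obtain ⟨k, hk⟩ := Multiset.le_iff_exists_add.1 hg₃
    have hk' := congrArg Multiset.sum hk
    rw [hs, Multiset.sum_add] at hk'
    exact hsub k (hk ▸ Multiset.le_add_left _ _) (by linear_combination -hk' - hg0)
  · exact hsub g₃ hg₃ (by linear_combination hg0)
  · exact h1 (by
      rw [hf.eq_of_le hg₃ (by rw [hs]; linear_combination hg0), Multiset.singleton_add,
        Multiset.singleton_add])

lemma IsRootOfUnity.neg {z : ℂ} (h : IsRootOfUnity z) : IsRootOfUnity (-z) := by
  obtain ⟨n, hn, h⟩ := h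
  exact ⟨2 * n, by omega, by rw [pow_mul, neg_sq, ← pow_mul, mul_comm, pow_mul, h, one_pow]⟩

lemma IsRootOfUnity.ne_zero {z : ℂ} (h : IsRootOfUnity z) : z ≠ 0 := by
  obtain ⟨n, hn, h⟩ := h
  rintro rfl
  rw [zero_pow hn.ne'] at h
  exact zero_ne_one h

lemma IsRootOfUnity.norm_eq_one {z : ℂ} (h : IsRootOfUnity z) : ‖z‖ = 1 := by
  obtain ⟨n, hn, h⟩ := h
  exact Complex.norm_eq_one_of_pow_eq_one h hn.ne'

lemma PrimeLevel.card_le {h : Multiset ℂ} {p m : ℕ} {ζ c α : ℂ} {f : ℕ → Multiset ℂ}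
    (L : PrimeLevel h p m ζ c α f) {d j : ℕ} (hd : ∀ i < p, d ≤ Multiset.card (f i)) (hj : j < p) :
    Multiset.card (f j) + (p - 1) * d ≤ Multiset.card h := by
  rw [L.card_eq, ← Finset.add_sum_erase _ _ (Finset.mem_range.2 hj)]
  refine Nat.add_le_add_left ((Finset.card_nsmul_le_sum _ _ d fun s hs => hd s
    (Finset.mem_range.1 (Finset.mem_of_mem_erase hs))).trans' ?_) _
  rw [Finset.card_erase_of_mem (Finset.mem_range.2 hj), Finset.card_range, smul_eq_mul]

lemma PrimeLevel.card_add_card_le {h : Multiset ℂ} {p m : ℕ} {ζ c α : ℂ} {f : ℕ → Multiset ℂ}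
    (L : PrimeLevel h p m ζ c α f) {d i j : ℕ} (hd : ∀ i < p, d ≤ Multiset.card (f i)) (hi : i < p)
    (hj : j < p) (hij : i ≠ j) :
    Multiset.card (f i) + Multiset.card (f j) + (p - 2) * d ≤ Multiset.card h := by
  have hj' := Finset.mem_erase.2 ⟨hij.symm, Finset.mem_range.2 hj⟩
  rw [L.card_eq, ← Finset.add_sum_erase _ _ (Finset.mem_range.2 hi),
    ← Finset.add_sum_erase _ _ hj', add_assoc]
  refine Nat.add_le_add_left (Nat.add_le_add_left ((Finset.card_nsmul_le_sum _ _ d fun s hs => hd s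
    (Finset.mem_range.1 (Finset.mem_of_mem_erase (Finset.mem_of_mem_erase hs)))).trans' ?_) _) _
  rw [Finset.card_erase_of_mem hj', Finset.card_erase_of_mem (Finset.mem_range.2 hi),
    Finset.card_range, smul_eq_mul, Nat.sub_sub]

lemma PrimeLevel.isRootOfUnity {h : Multiset ℂ} {p m : ℕ} {ζ c α : ℂ} {f : ℕ → Multiset ℂ}
    (L : PrimeLevel h p m ζ c α f) (hm : 0 < m) {j : ℕ} (hj : j < p) {u : ℂ} (hu : u ∈ f j) :
    IsRootOfUnity u :=
  ⟨m, hm, L.root j hj u hu⟩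

/-- All minimal vanishing sorous of smaller weight have height one. -/
def SmallerHeightOne (n : ℕ) : Prop :=
  ∀ h : Multiset ℂ, IsSorou h → IsMinVanishing h → Multiset.card h < n → ∀ z : ℂ, h.count z ≤ 1

lemma PrimeLevel.count_le_one_of_isRootOfUnity {h : Multiset ℂ} {p m : ℕ} {ζ c α : ℂ}
    {f : ℕ → Multiset ℂ} (L : PrimeLevel h p m ζ c α f) (hm : 0 < m) (hp : 3 ≤ p)
    (hα : IsRootOfUnity α) (IH : SmallerHeightOne (Multiset.card h)) (z : ℂ) : h.count z ≤ 1 := by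
  refine L.count_le (fun j hj u => ?_) z
  refine (Multiset.count_le_of_le u (Multiset.le_cons_self (f j) (-α))).trans (IH _ ⟨?_, ?_⟩
    (isMinVanishing_neg_cons (L.zsf j hj) (L.sum j hj)) ?_ u)
  · exact Multiset.cons_ne_zero
  · intro w hw
    rcases Multiset.mem_cons.1 hw with rfl | hw
    · exact hα.neg
    · exact L.isRootOfUnity hm hj hw
  · have := L.card_le (fun i hi => L.one_le_card hi) hj
    rw [Multiset.card_cons]
    omega

lemma PrimeLevel.isRootOfUnity_of_card_eq_one {h : Multiset ℂ} {p m : ℕ} {ζ c α : ℂ}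
    {f : ℕ → Multiset ℂ} (L : PrimeLevel h p m ζ c α f) (hm : 0 < m) {j : ℕ} (hj : j < p)
    (h1 : Multiset.card (f j) = 1) : IsRootOfUnity α := by
  obtain ⟨a, ha⟩ := Multiset.card_eq_one.1 h1
  have := L.sum j hj
  rw [ha, Multiset.sum_singleton] at this
  rw [← this]
  exact L.isRootOfUnity hm hj (by simp [ha])

lemma neg_pow_thirty (z : ℂ) : (-z) ^ 30 = z ^ 30 := Even.neg_pow ⟨15, rfl⟩ z

lemma PrimeLevel.count_le_of_pair {h : Multiset ℂ} {m : ℕ} {ζ c α : ℂ} {f : ℕ → Multiset ℂ}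
    (L : PrimeLevel h 7 m ζ c α f) (hm : m ∣ 30) (hα : ¬ IsRootOfUnity α)
    (h2 : ∀ j < 7, 2 ≤ Multiset.card (f j)) {l : ℕ} (hl : l < 7) (hfl : Multiset.card (f l) = 2)
    (z : ℂ) : h.count z ≤ 2 ∧ (Multiset.card h < 21 → h.count z ≤ 1) := by
  obtain ⟨a, b, hab⟩ := Multiset.card_eq_two.1 hfl
  have r30 : ∀ j < 7, ∀ u ∈ f j, u ^ 30 = 1 := fun j hj u hu =>
    pow_eq_one_of_dvd (L.root j hj u hu) hm
  have ne0 : ∀ u : ℂ, u ^ 30 = 1 → u ≠ 0 := by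
    rintro u hu rfl
    simp at hu
  have ha := r30 l hl a (by simp [hab])
  have hb := r30 l hl b (by simp [hab])
  have ha0 := ne0 a ha
  have hb0 := ne0 b hb
  have hsab : a + b = α := by simpa [hab] using L.sum l hl
  have nonsplit : ∀ i < 7, (∀ g ≤ f i, g.sum ≠ a) →
      IsMinVanishing (-a ::ₘ -b ::ₘ f i) ∧ ∀ x ∈ -a ::ₘ -b ::ₘ f i, x ^ 30 = 1 := by
    intro i hi H
    refine ⟨isMinVanishing_neg_pair (L.zsf i hi) ((L.sum i hi).trans hsab.symm) H, fun x hx => ?_⟩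
    rcases Multiset.mem_cons.1 hx with rfl | hx
    · exact (neg_pow_thirty a).trans ha
    rcases Multiset.mem_cons.1 hx with rfl | hx
    · exact (neg_pow_thirty b).trans hb
    · exact r30 i hi x hx
  have half : ∀ i < 7, ∀ g ≤ f i, ∀ s : ℂ, s ^ 30 = 1 → g.sum = s → ∀ x ∈ g,
      x / -s ≠ 1 ∧ RatioBound (Multiset.card g + 1) (x / -s) ∧ g.count x ≤ 1 := by
    intro i hi g hg s hs hgs x hx
    have hmin := isMinVanishing_neg_cons ((L.zsf i hi).mono hg) hgs
    have h30 : ∀ y ∈ -s ::ₘ g, y ^ 30 = 1 := by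
      intro y hy
      rcases Multiset.mem_cons.1 hy with rfl | hy
      · exact (neg_pow_thirty s).trans hs
      · exact r30 i hi y (Multiset.mem_of_le hg hy)
    obtain ⟨hne, hR⟩ := ratioBound_of_pow_thirty hmin h30 hx
    rw [Multiset.card_cons] at hR
    refine ⟨?_, hR, ?_⟩
    · rwa [Ne, div_eq_one_iff_eq (neg_ne_zero.2 (ne0 s hs))]
    · by_contra! hcount
      obtain ⟨g', rfl⟩ := Multiset.exists_cons_of_mem hx
      rw [Multiset.count_cons_self] at hcount
      rw [Multiset.cons_swap] at hmin h30
      exact (ratioBound_of_pow_thirty hmin h30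
        (Multiset.mem_cons_of_mem (Multiset.count_pos.1 (by omega)))).1 rfl
  have count_nonsplit : ∀ i < 7, (∀ g ≤ f i, g.sum ≠ a) → ∀ u, (f i).count u ≤ 1 := by
    intro i hi H u
    obtain ⟨hmin, h30⟩ := nonsplit i hi H
    by_contra! hcount
    obtain ⟨g', hg'⟩ := Multiset.exists_cons_of_mem (Multiset.count_pos.1 (by omega : 0 < (f i).count u))
    rw [hg', Multiset.count_cons_self] at hcount
    rw [hg', Multiset.cons_swap (-b), Multiset.cons_swap (-a)] at hmin h30
    exact (ratioBound_of_pow_thirty hmin h30 (Multiset.mem_cons_of_mem (Multiset.mem_cons_of_mem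
      (Multiset.count_pos.1 (by omega))))).1 rfl
  have split : ∀ i < 7, (∃ g ≤ f i, g.sum = a) →
      ∃ g₁ g₂, f i = g₁ + g₂ ∧ g₁.sum = a ∧ g₂.sum = b := by
    rintro i hi ⟨g, hg, hga⟩
    obtain ⟨k, hk⟩ := Multiset.le_iff_exists_add.1 hg
    refine ⟨g, k, hk, hga, ?_⟩
    have := L.sum i hi
    rw [hk, Multiset.sum_add] at this
    linear_combination this - hga - hsab
  have count_half : ∀ i < 7, ∀ g ≤ f i, ∀ s : ℂ, s ^ 30 = 1 → g.sum = s → ∀ x, g.count x ≤ 1 := by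
    intro i hi g hg s hs hgs x
    by_cases hx : x ∈ g
    · exact (half i hi g hg s hs hgs x hx).2.2
    · rw [Multiset.count_eq_zero_of_notMem hx]
      exact zero_le_one
  constructor
  · refine L.count_le (fun i hi u => ?_) z
    by_cases hsp : ∃ g ≤ f i, g.sum = a
    · obtain ⟨g₁, g₂, hg, hg₁, hg₂⟩ := split i hi hsp
      have h1 := count_half i hi g₁ (hg ▸ Multiset.le_add_right _ _) a ha hg₁ u
      have h2 := count_half i hi g₂ (hg ▸ Multiset.le_add_left _ _) b hb hg₂ u
      rw [hg, Multiset.count_add]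
      omega
    · push Not at hsp
      exact (count_nonsplit i hi hsp u).trans one_le_two
  · intro hcard
    refine L.count_le (fun i hi u => ?_) z
    by_cases hsp : ∃ g ≤ f i, g.sum = a
    · obtain ⟨g₁, g₂, hg, hg₁, hg₂⟩ := split i hi hsp
      have hle₁ : g₁ ≤ f i := hg ▸ Multiset.le_add_right _ _
      have hle₂ : g₂ ≤ f i := hg ▸ Multiset.le_add_left _ _
      by_contra! hcount
      have c1 := count_half i hi g₁ hle₁ a ha hg₁ u
      have c2 := count_half i hi g₂ hle₂ b hb hg₂ u
      rw [hg, Multiset.count_add] at hcount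
      obtain ⟨n₁, R₁, -⟩ := half i hi g₁ hle₁ a ha hg₁ u (Multiset.count_pos.1 (by omega))
      obtain ⟨n₂, R₂, -⟩ := half i hi g₂ hle₂ b hb hg₂ u (Multiset.count_pos.1 (by omega))
      obtain ⟨j, hj, hnon⟩ : ∃ j < 7, ∀ g ≤ f j, g.sum ≠ a := by
        by_contra! H
        have := L.split a ha0 H
        exact hb0 (by linear_combination hsab - this)
      obtain ⟨hmin, h30⟩ := nonsplit j hj hnon
      obtain ⟨-, R⟩ := ratioBound_of_pow_thirty hmin h30 (Multiset.mem_cons_self _ _)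
      have hij : i ≠ j := by
        rintro rfl
        exact hnon g₁ hle₁ hg₁
      have hbound := R₁.bound R₂ R (by field_simp) n₁ n₂ ?_ ?_
      · have hc := L.card_add_card_le h2 hi hj hij
        have hgi := congrArg Multiset.card hg
        simp only [Multiset.card_cons, Multiset.card_add] at hbound hgi
        omega
      · rw [neg_div_neg_eq]
        intro h3
        by_cases h1 : b = a
        · exact (ratioBound_of_pow_thirty hmin h30 (Multiset.mem_cons_self _ _)).1 (by rw [h1])
        · have hsum : α = -(a * (b / a) ^ 2) := by
            have h4 : b / a - 1 ≠ 0 := by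
              rwa [Ne, sub_eq_zero, div_eq_one_iff_eq ha0]
            have h5 : (b / a) ^ 2 + b / a + 1 = 0 :=
              mul_left_cancel₀ h4 (by linear_combination h3)
            have h6 : b = a * (b / a) := by field_simp
            rw [← hsab]
            linear_combination a * h5 + h6
          refine hα ⟨30, by norm_num, ?_⟩
          rw [hsum, neg_pow_thirty, mul_pow, ha, ← pow_mul, div_pow, pow_mul b 30 2, pow_mul a 30 2,
            ha, hb]
          norm_num
      · have := h2 j hj
        simp only [Multiset.card_cons]
        omega
    · push Not at hsp
      exact count_nonsplit i hi hsp u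

lemma eq_of_sum_eq_three_mul {x u v w : ℂ} (hx : ‖x‖ = 1) (hu : ‖u‖ = 1) (hv : ‖v‖ = 1)
    (hw : ‖w‖ = 1) (h : u + v + w = 3 * x) : u = x := by
  have hx0 : x ≠ 0 := by
    rintro rfl
    simp at hx
  have re_le : ∀ y : ℂ, ‖y‖ = 1 → (y / x).re ≤ 1 := fun y hy =>
    (Complex.re_le_norm _).trans (by rw [norm_div, hx, hy, div_one])
  have h3 : u / x + v / x + w / x = 3 := by
    rw [← add_div, ← add_div, h]
    field_simp
  have hre := congrArg Complex.re h3
  simp only [Complex.add_re, Complex.re_ofNat] at hre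
  have h1 : (u / x).re = ‖u / x‖ := by
    rw [norm_div, hx, hu, div_one]
    linarith [re_le u hu, re_le v hv, re_le w hw]
  have h4 := Complex.re_eq_norm.1 h1
  have h5 := Complex.eq_re_of_ofReal_le (r := 0) (by simpa using h4)
  rw [h1, norm_div, hx, hu, div_one, Complex.ofReal_one, div_eq_one_iff_eq hx0] at h5
  exact h5

lemma PrimeLevel.count_le_two_of_card_eq_three {h : Multiset ℂ} {p m : ℕ} {ζ c α : ℂ}
    {f : ℕ → Multiset ℂ} (L : PrimeLevel h p m ζ c α f) (hm : 0 < m)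
    (h3 : ∀ j < p, Multiset.card (f j) = 3) (z : ℂ) : h.count z ≤ 2 := by
  refine L.count_le (fun i hi x => ?_) z
  by_contra! hcount
  have hx : f i = Multiset.replicate 3 x :=
    (Multiset.eq_of_le_of_card_le (Multiset.le_count_iff_replicate_le.1 hcount)
      (by rw [h3 i hi, Multiset.card_replicate])).symm
  have hxr : IsRootOfUnity x := L.isRootOfUnity hm hi (by simp [hx])
  have hα : α = 3 * x := by rw [← L.sum i hi, hx]; simp; ring
  have := L.split x hxr.ne_zero fun j hj => by
    obtain ⟨u, v, w, huvw⟩ := Multiset.card_eq_three.1 (h3 j hj)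
    have norm1 : ∀ y ∈ f j, ‖y‖ = 1 := fun y hy => (L.isRootOfUnity hm hj hy).norm_eq_one
    have hs := L.sum j hj
    rw [hα, huvw] at hs
    have hux : u = x := eq_of_sum_eq_three_mul (v := v) (w := w) hxr.norm_eq_one
      (norm1 u (by simp [huvw])) (norm1 v (by simp [huvw])) (norm1 w (by simp [huvw]))
      (by rw [← hs]; simp [add_assoc])
    exact ⟨{x}, by simp [huvw, hux], by simp⟩
  exact hxr.ne_zero (by linear_combination (this.trans hα) * (-1 / 2))

lemma IsSorou.exists_pow_eq_one {h : Multiset ℂ} (hh : ∀ z ∈ h, IsRootOfUnity z) :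
    ∃ M : ℕ, 0 < M ∧ ∀ z ∈ h, z ^ M = 1 := by
  induction h using Multiset.induction with
  | empty => exact ⟨1, one_pos, by simp⟩
  | cons a h ih =>
    obtain ⟨M, hM, hMz⟩ := ih fun z hz => hh z (Multiset.mem_cons_of_mem hz)
    obtain ⟨n, hn, ha⟩ := hh a (Multiset.mem_cons_self _ _)
    refine ⟨n * M, Nat.mul_pos hn hM, fun z hz => ?_⟩
    rcases Multiset.mem_cons.1 hz with rfl | hz
    · exact pow_eq_one_of_dvd ha (Dvd.intro _ rfl)
    · exact pow_eq_one_of_dvd (hMz z hz) (Dvd.intro_left _ rfl)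

lemma IsMinVanishing.count_le {h : Multiset ℂ} (hs : IsSorou h) (hh : IsMinVanishing h)
    (hcard : Multiset.card h ≤ 21) (IH : SmallerHeightOne (Multiset.card h)) (z : ℂ) :
    h.count z ≤ 2 ∧ (Multiset.card h < 21 → h.count z ≤ 1) := by
  obtain ⟨M, hM, hroot⟩ := IsSorou.exists_pow_eq_one hs.2
  obtain ⟨p, m, ζ, c, α, f, hpm, hsq, hlt, L⟩ := exists_primeLevel hs.1 hh hM hroot
  have hm : 0 < m := Nat.pos_of_ne_zero hsq.ne_zero
  have of_one : h.count z ≤ 1 → h.count z ≤ 2 ∧ (Multiset.card h < 21 → h.count z ≤ 1) :=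
    fun h1 => ⟨h1.trans one_le_two, fun _ => h1⟩
  rcases le_or_gt p 5 with hp5 | hp5
  · exact of_one (L.count_le_one_of_dvd_six (dvd_six_of_primes_lt_five hsq hlt hp5) z)
  by_cases hα : IsRootOfUnity α
  · exact of_one (L.count_le_one_of_isRootOfUnity hm (by omega) hα IH z)
  have h2 : ∀ j < p, 2 ≤ Multiset.card (f j) := by
    intro j hj
    have := L.one_le_card hj
    by_contra! H
    exact hα (L.isRootOfUnity_of_card_eq_one hm hj (by omega))
  have hp7 : p = 7 := by
    have h1 := L.card_le h2 L.prime.pos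
    have h3 := h2 0 L.prime.pos
    have hp := L.prime
    have : p < 11 := by omega
    interval_cases p <;> first | rfl | (exfalso; revert hp; decide)
  subst hp7
  by_cases hpair : ∃ l < 7, Multiset.card (f l) = 2
  · obtain ⟨l, hl, hfl⟩ := hpair
    exact L.count_le_of_pair (dvd_thirty_of_primes_lt_seven hsq hlt) hα h2 hl hfl z
  · push Not at hpair
    have h3 : ∀ j < 7, 3 ≤ Multiset.card (f j) := fun j hj => by
      have := h2 j hj
      have := hpair j hj
      omega
    refine ⟨L.count_le_two_of_card_eq_three hm (fun j hj => ?_) z, fun hlt => ?_⟩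
    · have := h3 j hj
      have := L.card_le h3 hj
      omega
    · have := h3 0 (by norm_num)
      have := L.card_le h3 (by norm_num : 0 < 7)
      omega

lemma smallerHeightOne {n : ℕ} (hn : n ≤ 21) : SmallerHeightOne n := by
  induction n with
  | zero => exact fun h _ _ hc => absurd hc (Nat.not_lt_zero _)
  | succ n ih =>
    intro h hs hh hc z
    rcases Nat.lt_succ_iff_lt_or_eq.1 hc with hlt | rfl
    · exact ih (by omega) h hs hh hlt z
    · exact (hh.count_le hs (by omega) (ih (by omega)) z).2 (by omega)

lemma exists_map_eq_of_le_map {g f : Multiset ℂ} {φ : ℂ → ℂ} (h : g ≤ f.map φ) :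
    ∃ k ≤ f, k.map φ = g := by
  induction f using Multiset.induction generalizing g with
  | empty => exact ⟨0, le_rfl, by simpa using h.antisymm' (Multiset.zero_le _)⟩
  | cons a f ih =>
    rw [Multiset.map_cons, ← Multiset.singleton_add] at h
    obtain ⟨g₁, h₁, g₂, h₂, rfl⟩ := exists_add_of_le_add h
    obtain ⟨k, hk, rfl⟩ := ih h₂
    rcases eq_zero_or_eq_singleton_of_le h₁ with rfl | rfl
    · exact ⟨k, hk.trans (Multiset.le_cons_self _ _), by simp⟩
    · exact ⟨a ::ₘ k, (Multiset.cons_le_cons_iff a).2 hk, by simp⟩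

lemma exists_eq_assemble_of_le {p : ℕ} {ζ c : ℂ} {f : ℕ → Multiset ℂ} {g : Multiset ℂ}
    (hg : g ≤ assemble p ζ c f) :
    ∃ G : ℕ → Multiset ℂ, (∀ j, G j ≤ f j) ∧ g = assemble p ζ c G := by
  obtain ⟨G', hG', rfl⟩ := exists_sum_of_le_sum hg
  choose G hG hGG using fun j => exists_map_eq_of_le_map (hG' j)
  exact ⟨G, hG, Finset.sum_congr rfl fun j _ => (hGG j).symm⟩

lemma exists_eq_assemble_of_sum_eq {p m : ℕ} (hp : p.Prime) (hm : 0 < m) (hpm : p.Coprime m)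
    {ζ : ℂ} (hζ : IsPrimitiveRoot ζ p) {f : ℕ → Multiset ℂ} (hf : ∀ j < p, ∀ u ∈ f j, u ^ m = 1)
    {t : ℕ → Multiset ℂ} (ht : ∀ j < p, ∀ u ∈ t j, u ^ m = 1) {g : Multiset ℂ}
    (hg : g ≤ assemble p ζ 1 f) (hs : g.sum = (assemble p ζ 1 t).sum) :
    ∃ G : ℕ → Multiset ℂ, (∀ j, G j ≤ f j) ∧ g = assemble p ζ 1 G ∧
      ∃ d, ∀ j < p, (G j).sum = (t j).sum + d := by
  obtain ⟨G, hG, rfl⟩ := exists_eq_assemble_of_le hg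
  have : NeZero m := ⟨hm.ne'⟩
  have hη := Complex.isPrimitiveRoot_exp m hm.ne'
  have key := eq_of_sum_pow_mul_eq_zero_of_coprime hp hm hpm hη hζ
    (x := fun j => (G j).sum - (t j).sum)
    (fun j hj => sub_mem
      (sum_mem_adjoin hη fun u hu => hf j hj u (Multiset.mem_of_le (hG j) hu))
      (sum_mem_adjoin hη (ht j hj)))
    (by
      rw [sum_assemble, sum_assemble, one_mul, one_mul] at hs
      simp only [mul_sub, Finset.sum_sub_distrib, hs, sub_self])
  exact ⟨G, hG, rfl, _, fun j hj => sub_eq_iff_eq_add'.1 (key j hj)⟩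

lemma zeroSumFree_assemble {p m : ℕ} (hp : p.Prime) (hm : 0 < m) (hpm : p.Coprime m)
    {ζ : ℂ} (hζ : IsPrimitiveRoot ζ p) {f : ℕ → Multiset ℂ} (hf : ∀ j < p, ∀ u ∈ f j, u ^ m = 1)
    (hz : ∀ j < p, ZeroSumFree (f j)) (hd : ∀ d, (∀ j < p, ∃ g ≤ f j, g.sum = d) → d = 0) :
    ZeroSumFree (assemble p ζ 1 f) := by
  intro g hg hs
  obtain ⟨G, hG, rfl, d, hGd⟩ := exists_eq_assemble_of_sum_eq hp hm hpm hζ hf (t := fun _ => 0)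
    (by simp) hg (by rw [hs, sum_assemble]; simp)
  simp only [Multiset.sum_zero, zero_add] at hGd
  have hd0 := hd d fun j hj => ⟨G j, hG j, hGd j hj⟩
  refine Finset.sum_eq_zero fun j hj => ?_
  rw [Finset.mem_range] at hj
  rw [hz j hj _ (hG j) ((hGd j hj).trans hd0), Multiset.map_zero]

lemma isMinVanishing_assemble {p m : ℕ} (hp : p.Prime) (hm : 0 < m) (hpm : p.Coprime m)
    {ζ α : ℂ} (hζ : IsPrimitiveRoot ζ p) {f : ℕ → Multiset ℂ}
    (hf : ∀ j < p, ∀ u ∈ f j, u ^ m = 1) (hα : ∀ j < p, (f j).sum = α)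
    (hz : ∀ j < p, ZeroSumFree (f j))
    (hsplit : ∀ β ≠ 0, (∀ j < p, ∃ g ≤ f j, g.sum = β) → β = α) :
    IsMinVanishing (assemble p ζ 1 f) := by
  refine ⟨?_, fun g hg h0 h1 hs => ?_⟩
  · rw [sum_assemble, Finset.sum_congr rfl fun j hj => by rw [hα j (Finset.mem_range.1 hj)],
      ← Finset.sum_mul, hζ.geom_sum_eq_zero hp.one_lt, zero_mul, mul_zero]
  obtain ⟨G, hG, rfl, β, hGβ⟩ := exists_eq_assemble_of_sum_eq hp hm hpm hζ hf (t := fun _ => 0)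
    (by simp) hg (by rw [hs, sum_assemble]; simp)
  simp only [Multiset.sum_zero, zero_add] at hGβ
  by_cases hβ : β = 0
  · refine h0 (Finset.sum_eq_zero fun j hj => ?_)
    rw [Finset.mem_range] at hj
    rw [hz j hj _ (hG j) ((hGβ j hj).trans hβ), Multiset.map_zero]
  · have hβα := hsplit β hβ fun j hj => ⟨G j, hG j, hGβ j hj⟩
    refine h1 (Finset.sum_congr rfl fun j hj => ?_)
    rw [Finset.mem_range] at hj
    rw [(hz j hj).eq_of_le (hG j) (by rw [hGβ j hj, hβα, hα j hj])]

lemma zeroSumFree_replicate {a : ℂ} (ha : a ≠ 0) (n : ℕ) :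
    ZeroSumFree (Multiset.replicate n a) := by
  intro g hg hs
  have hg' : g = Multiset.replicate (Multiset.card g) a :=
    Multiset.eq_replicate.2 ⟨rfl, fun b hb => Multiset.eq_of_mem_replicate (Multiset.mem_of_le hg hb)⟩
  rw [hg', Multiset.sum_replicate, nsmul_eq_mul, mul_eq_zero, Nat.cast_eq_zero] at hs
  exact Multiset.card_eq_zero.1 (hs.resolve_right ha)

lemma sum_of_le_singleton {g : Multiset ℂ} {a : ℂ} (h : g ≤ {a}) : g.sum = 0 ∨ g.sum = a := by
  rcases eq_zero_or_eq_singleton_of_le h with rfl | rfl <;> simp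

lemma le_assemble {p : ℕ} (hp : 0 < p) (ζ : ℂ) (f : ℕ → Multiset ℂ) : f 0 ≤ assemble p ζ 1 f := by
  have := Finset.single_le_sum (f := fun j => (f j).map (1 * ζ ^ j * ·))
    (fun _ _ => Multiset.zero_le _) (Finset.mem_range.2 hp)
  simpa [assemble] using this

/-- The components of the six-term part of the extremal sorou along powers of a fifth root of
unity. -/
def sixPart (ω : ℂ) : ℕ → Multiset ℂ
  | 0 => Multiset.replicate 2 ω
  | 1 => {-1}
  | _ => {ω}

/-- The components of the five-term part of the extremal sorou. -/
def fivePart (ω : ℂ) : ℕ → Multiset ℂ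
  | 0 => {-ω ^ 2}
  | 1 => {-ω}
  | _ => {1}

/-- The components of the two-term parts of the extremal sorou. -/
def twoPart (ω : ℂ) : ℕ → Multiset ℂ
  | 0 => {ω}
  | 1 => {ω ^ 2}
  | _ => 0

/-- The parts of the extremal sorou along powers of a seventh root of unity. -/
noncomputable def extremalParts (ω ζ : ℂ) : ℕ → Multiset ℂ
  | 0 => assemble 5 ζ 1 (sixPart ω)
  | 1 => assemble 5 ζ 1 (fivePart ω)
  | _ => assemble 5 ζ 1 (twoPart ω)

section Extremal

variable {ω ζ : ℂ}

lemma pow_three_eq_one (hω : ω ^ 2 + ω + 1 = 0) : ω ^ 3 = 1 := by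
  linear_combination (ω - 1) * hω

lemma ne_zero_of_sq_add_self_add_one (hω : ω ^ 2 + ω + 1 = 0) : ω ≠ 0 := by
  rintro rfl
  norm_num at hω

lemma ne_neg_one_of_sq_add_self_add_one (hω : ω ^ 2 + ω + 1 = 0) : ω ≠ -1 := by
  rintro rfl
  norm_num at hω

lemma sixPart_root (hω : ω ^ 2 + ω + 1 = 0) (j : ℕ) : ∀ u ∈ sixPart ω j, u ^ 6 = 1 := by
  have h3 := pow_three_eq_one hω
  have h6 : ω ^ 6 = 1 := by linear_combination (ω ^ 3 + 1) * h3
  match j with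
  | 0 => simp [sixPart, h6]
  | 1 => simp [sixPart, Even.neg_pow (⟨3, rfl⟩ : Even 6)]
  | j + 2 => simp [sixPart, h6]

lemma fivePart_root (hω : ω ^ 2 + ω + 1 = 0) (j : ℕ) : ∀ u ∈ fivePart ω j, u ^ 6 = 1 := by
  have h3 := pow_three_eq_one hω
  have h6 : ω ^ 6 = 1 := by linear_combination (ω ^ 3 + 1) * h3
  have h12 : (ω ^ 2) ^ 6 = 1 := by rw [← pow_mul, mul_comm, pow_mul, h6, one_pow]
  match j with
  | 0 => simp [fivePart, Even.neg_pow (⟨3, rfl⟩ : Even 6), h12]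
  | 1 => simp [fivePart, Even.neg_pow (⟨3, rfl⟩ : Even 6), h6]
  | j + 2 => simp [fivePart]

lemma twoPart_root (hω : ω ^ 2 + ω + 1 = 0) (j : ℕ) : ∀ u ∈ twoPart ω j, u ^ 6 = 1 := by
  have h3 := pow_three_eq_one hω
  have h6 : ω ^ 6 = 1 := by linear_combination (ω ^ 3 + 1) * h3
  have h12 : (ω ^ 2) ^ 6 = 1 := by rw [← pow_mul, mul_comm, pow_mul, h6, one_pow]
  match j with
  | 0 => simp [twoPart, h6]
  | 1 => simp [twoPart, h12]
  | j + 2 => simp [twoPart]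

lemma zeroSumFree_singleton {a : ℂ} (ha : a ≠ 0) : ZeroSumFree {a} := by
  simpa using zeroSumFree_replicate ha 1

lemma zeroSumFree_sixPart (hω : ω ^ 2 + ω + 1 = 0) (hζ : IsPrimitiveRoot ζ 5) :
    ZeroSumFree (assemble 5 ζ 1 (sixPart ω)) := by
  have h0 := ne_zero_of_sq_add_self_add_one hω
  refine zeroSumFree_assemble (m := 6) (by norm_num) (by norm_num) (by norm_num) hζ
    (fun j _ => sixPart_root hω j) (fun j _ => ?_) fun d H => ?_
  · match j with
    | 0 => exact zeroSumFree_replicate h0 2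
    | 1 => exact zeroSumFree_singleton (by norm_num)
    | j + 2 => exact zeroSumFree_singleton h0
  · obtain ⟨g, hg, rfl⟩ := H 1 (by norm_num)
    obtain ⟨k, hk, hkg⟩ := H 2 (by norm_num)
    rcases sum_of_le_singleton hg with h | h
    · exact h
    rcases sum_of_le_singleton hk with h' | h'
    · rw [← hkg, h']
    · exact absurd (h'.symm.trans (hkg.trans h)) (ne_neg_one_of_sq_add_self_add_one hω)

lemma zeroSumFree_fivePart (hω : ω ^ 2 + ω + 1 = 0) (hζ : IsPrimitiveRoot ζ 5) :
    ZeroSumFree (assemble 5 ζ 1 (fivePart ω)) := by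
  have h0 := ne_zero_of_sq_add_self_add_one hω
  refine zeroSumFree_assemble (m := 6) (by norm_num) (by norm_num) (by norm_num) hζ
    (fun j _ => fivePart_root hω j) (fun j _ => ?_) fun d H => ?_
  · match j with
    | 0 => exact zeroSumFree_singleton (neg_ne_zero.2 (pow_ne_zero 2 h0))
    | 1 => exact zeroSumFree_singleton (neg_ne_zero.2 h0)
    | j + 2 => exact zeroSumFree_singleton one_ne_zero
  · obtain ⟨g, hg, rfl⟩ := H 1 (by norm_num)
    obtain ⟨k, hk, hkg⟩ := H 2 (by norm_num)
    rcases sum_of_le_singleton hg with h | h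
    · exact h
    rcases sum_of_le_singleton hk with h' | h'
    · rw [← hkg, h']
    · exact absurd (by linear_combination hkg - h' + h)
        (ne_neg_one_of_sq_add_self_add_one hω)

lemma zeroSumFree_twoPart (hω : ω ^ 2 + ω + 1 = 0) (hζ : IsPrimitiveRoot ζ 5) :
    ZeroSumFree (assemble 5 ζ 1 (twoPart ω)) := by
  have h0 := ne_zero_of_sq_add_self_add_one hω
  refine zeroSumFree_assemble (m := 6) (by norm_num) (by norm_num) (by norm_num) hζ
    (fun j _ => twoPart_root hω j) (fun j _ => ?_) fun d H => ?_
  · match j with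
    | 0 => exact zeroSumFree_singleton h0
    | 1 => exact zeroSumFree_singleton (pow_ne_zero 2 h0)
    | j + 2 => exact fun g hg _ => Multiset.le_zero.1 hg
  · obtain ⟨g, hg, rfl⟩ := H 2 (by norm_num)
    rw [Multiset.le_zero.1 hg, Multiset.sum_zero]

lemma eq_zero_or_eq_of_common_sum (hω : ω ^ 2 + ω + 1 = 0) (hζ : IsPrimitiveRoot ζ 5)
    {g k : Multiset ℂ} (hg : g ≤ assemble 5 ζ 1 (fivePart ω))
    (hk : k ≤ assemble 5 ζ 1 (twoPart ω)) (h : g.sum = k.sum) :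
    k = 0 ∨ k = assemble 5 ζ 1 (twoPart ω) := by
  have h0 := ne_zero_of_sq_add_self_add_one hω
  have h1 := ne_neg_one_of_sq_add_self_add_one hω
  have hz := zeroSumFree_twoPart hω hζ
  obtain ⟨K, hK, rfl⟩ := exists_eq_assemble_of_le hk
  obtain ⟨G, hG, rfl, d, hGd⟩ := exists_eq_assemble_of_sum_eq (m := 6) (by norm_num) (by norm_num)
    (by norm_num) hζ (fun j _ => fivePart_root hω j)
    (fun j _ u hu => twoPart_root hω j u (Multiset.mem_of_le (hK j) hu)) hg h
  have hK' : ∀ j, K (j + 2) = 0 := fun j => Multiset.le_zero.1 (hK (j + 2))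
  have e0 := hGd 0 (by norm_num)
  have e1 := hGd 1 (by norm_num)
  have e2 := hGd 2 (by norm_num)
  rw [hK', Multiset.sum_zero, zero_add] at e2
  have sK : (assemble 5 ζ 1 K).sum = (K 0).sum + ζ * (K 1).sum := by
    simp [sum_assemble, Finset.sum_range_succ, hK' 0, hK' 1, hK' 2]
  have sT : (assemble 5 ζ 1 (twoPart ω)).sum = ω + ζ * ω ^ 2 := by
    simp [sum_assemble, Finset.sum_range_succ, twoPart]
  have absurd_of : ∀ {P : Prop}, ω * (ω + 1) = 0 → P := fun h => by
    rcases mul_eq_zero.1 h with h | h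
    · exact absurd h h0
    · exact absurd (eq_neg_of_add_eq_zero_left h) h1
  rcases sum_of_le_singleton (hG 2) with g2 | g2
  · left
    have k0 : (K 0).sum = 0 := by
      rcases sum_of_le_singleton (hK 0) with k | k
      · exact k
      rcases sum_of_le_singleton (hG 0) with g | g
      · exact absurd (by linear_combination e0 - g + k + g2 - e2) h0.symm
      · exact absurd_of (by linear_combination g - e0 - k - g2 + e2)
    have k1 : (K 1).sum = 0 := by
      rcases sum_of_le_singleton (hK 1) with k | k
      · exact k
      rcases sum_of_le_singleton (hG 1) with g | g
      · exact absurd (by linear_combination e1 - g + k + g2 - e2) (pow_ne_zero 2 h0).symm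
      · exact absurd_of (by linear_combination g - e1 - k - g2 + e2)
    exact hz _ hk (by rw [sK, k0, k1]; ring)
  · right
    have k0 : (K 0).sum = ω := by
      rcases sum_of_le_singleton (hK 0) with k | k
      · rcases sum_of_le_singleton (hG 0) with g | g
        · exact absurd (by linear_combination g - e0 - k - g2 + e2) one_ne_zero
        · exact absurd (by linear_combination hω - (g - e0 - k - g2 + e2)) h0
      · exact k
    have k1 : (K 1).sum = ω ^ 2 := by
      rcases sum_of_le_singleton (hK 1) with k | k
      · rcases sum_of_le_singleton (hG 1) with g | g
        · exact absurd (by linear_combination g - e1 - k - g2 + e2) one_ne_zero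
        · exact absurd (by linear_combination g - e1 - k - g2 + e2) h1
      · exact k
    exact hz.eq_of_le hk (by rw [sK, sT, k0, k1])

lemma sum_sixPart (hω : ω ^ 2 + ω + 1 = 0) (hζ : IsPrimitiveRoot ζ 5) :
    (assemble 5 ζ 1 (sixPart ω)).sum = (assemble 5 ζ 1 (twoPart ω)).sum := by
  have h := hζ.geom_sum_eq_zero (by norm_num)
  simp [Finset.sum_range_succ] at h
  simp [sum_assemble, Finset.sum_range_succ, sixPart, twoPart]
  linear_combination ω * h - ζ * hω

lemma sum_fivePart (hω : ω ^ 2 + ω + 1 = 0) (hζ : IsPrimitiveRoot ζ 5) :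
    (assemble 5 ζ 1 (fivePart ω)).sum = (assemble 5 ζ 1 (twoPart ω)).sum := by
  have h := hζ.geom_sum_eq_zero (by norm_num)
  simp [Finset.sum_range_succ] at h
  simp [sum_assemble, Finset.sum_range_succ, fivePart, twoPart]
  linear_combination h - (ζ + 1) * hω

lemma assemble_root {f : ℕ → Multiset ℂ} (hζ : IsPrimitiveRoot ζ 5)
    (hf : ∀ j, ∀ u ∈ f j, u ^ 6 = 1) : ∀ u ∈ assemble 5 ζ 1 f, u ^ 30 = 1 := by
  intro z hz
  obtain ⟨j, -, u, hu, rfl⟩ := mem_assemble.1 hz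
  rw [one_mul, mul_pow, ← pow_mul, mul_comm j, pow_mul,
    pow_eq_one_of_dvd hζ.pow_eq_one (by norm_num : 5 ∣ 30), one_pow, one_mul]
  exact pow_eq_one_of_dvd (hf j u hu) (by norm_num)

lemma extremalParts_root (hω : ω ^ 2 + ω + 1 = 0) (hζ : IsPrimitiveRoot ζ 5) (j : ℕ) :
    ∀ u ∈ extremalParts ω ζ j, u ^ 30 = 1 := by
  match j with
  | 0 => exact assemble_root hζ (sixPart_root hω)
  | 1 => exact assemble_root hζ (fivePart_root hω)
  | j + 2 => exact assemble_root hζ (twoPart_root hω)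

lemma isMinVanishing_extremal (hω : ω ^ 2 + ω + 1 = 0) (hζ : IsPrimitiveRoot ζ 5) {ξ : ℂ}
    (hξ : IsPrimitiveRoot ξ 7) : IsMinVanishing (assemble 7 ξ 1 (extremalParts ω ζ)) := by
  refine isMinVanishing_assemble (m := 30) (by norm_num) (by norm_num) (by norm_num) hξ
    (fun j _ => extremalParts_root hω hζ j) (α := (assemble 5 ζ 1 (twoPart ω)).sum)
    (fun j _ => ?_) (fun j _ => ?_) fun β hβ H => ?_
  · match j with
    | 0 => exact sum_sixPart hω hζ
    | 1 => exact sum_fivePart hω hζ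
    | j + 2 => rfl
  · match j with
    | 0 => exact zeroSumFree_sixPart hω hζ
    | 1 => exact zeroSumFree_fivePart hω hζ
    | j + 2 => exact zeroSumFree_twoPart hω hζ
  · obtain ⟨g, hg, hgβ⟩ := H 1 (by norm_num)
    obtain ⟨k, hk, hkβ⟩ := H 2 (by norm_num)
    rcases eq_zero_or_eq_of_common_sum hω hζ hg hk (hgβ.trans hkβ.symm) with rfl | rfl
    · exact absurd hkβ.symm hβ
    · exact hkβ.symm

end Extremal

lemma exists_isMinVanishing_count_eq_two :
    ∃ h : Multiset ℂ, IsSorou h ∧ IsMinVanishing h ∧ Multiset.card h = 21 ∧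
      (∀ w : ℂ, h.count w ≤ 2) ∧ ∃ z : ℂ, h.count z = 2 := by
  obtain ⟨ω, hω⟩ : ∃ ω : ℂ, ω ^ 2 + ω + 1 = 0 :=
    ⟨tau - 1, by linear_combination tau_sq⟩
  obtain ⟨ζ, hζ⟩ : ∃ ζ : ℂ, IsPrimitiveRoot ζ 5 := ⟨_, Complex.isPrimitiveRoot_exp 5 (by norm_num)⟩
  obtain ⟨ξ, hξ⟩ : ∃ ξ : ℂ, IsPrimitiveRoot ξ 7 := ⟨_, Complex.isPrimitiveRoot_exp 7 (by norm_num)⟩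
  have hmin := isMinVanishing_extremal hω hζ hξ
  have hcard : Multiset.card (assemble 7 ξ 1 (extremalParts ω ζ)) = 21 := by
    simp [card_assemble, Finset.sum_range_succ, extremalParts, sixPart, fivePart, twoPart]
  have hle : Multiset.replicate 2 ω ≤ assemble 7 ξ 1 (extremalParts ω ζ) :=
    (le_assemble (by norm_num : 0 < 5) ζ (sixPart ω)).trans
      (le_assemble (by norm_num : 0 < 7) ξ (extremalParts ω ζ))
  have hsorou : IsSorou (assemble 7 ξ 1 (extremalParts ω ζ)) := by
    refine ⟨fun h => by simp [h] at hcard, fun z hz => ?_⟩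
    obtain ⟨j, -, u, hu, rfl⟩ := mem_assemble.1 hz
    refine ⟨210, by norm_num, ?_⟩
    rw [one_mul, mul_pow, ← pow_mul, mul_comm j, pow_mul,
      pow_eq_one_of_dvd hξ.pow_eq_one (by norm_num), one_pow, one_mul]
    exact pow_eq_one_of_dvd (extremalParts_root hω hζ j u hu) (by norm_num)
  have hcount := fun w => (hmin.count_le hsorou hcard.le (smallerHeightOne hcard.le) w).1
  exact ⟨_, hsorou, hmin, hcard, hcount, ω,
    (hcount ω).antisymm (Multiset.le_count_iff_replicate_le.2 hle)⟩

theorem stmt_9 :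
    (∀ h : Multiset ℂ, IsSorou h → IsMinVanishing h → Multiset.card h < 21 →
      ∀ z : ℂ, h.count z ≤ 1) ∧
    (∀ h : Multiset ℂ, IsSorou h → IsMinVanishing h → Multiset.card h = 21 →
      ∀ z : ℂ, h.count z ≤ 2) ∧
    (∃ h : Multiset ℂ, IsSorou h ∧ IsMinVanishing h ∧ Multiset.card h = 21 ∧
      (∀ w : ℂ, h.count w ≤ 2) ∧ ∃ z : ℂ, h.count z = 2) :=
  ⟨smallerHeightOne le_rfl,
    fun _ hs hh hc z => (hh.count_le hs hc.le (smallerHeightOne hc.le) z).1,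
    exists_isMinVanishing_count_eq_two⟩
end

section
/- Let h be the multiset sum of the rotations ν_7^j·f_j for j = 0, …, 6, where f_j = {1, ν_3ν_5^4} for j ∈ {0,1,2,3,5}, f_4 = {−ν_3, −ν_5^4, ν_3^2ν_5, ν_3^2ν_5^2, ν_3^2ν_5^3}, and f_6 = {−ν_5, −ν_5^2, −ν_5^3, −ν_5^4, −ν_5^4, −ν_3^2ν_5^4} (where −ν_5^4 occurs with multiplicity 2). Then h is a minimal vanishing sorou of weight 21 and height 2. -/
open Complex

noncomputable def stmt10Sorou : Multiset ℂ :=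
  (({0, 1, 2, 3, 5} : Multiset ℕ).bind fun j =>
      ({1, nu 3 * nu 5 ^ 4} : Multiset ℂ).map fun w => nu 7 ^ j * w) +
  (({-nu 3, -(nu 5 ^ 4), nu 3 ^ 2 * nu 5, nu 3 ^ 2 * nu 5 ^ 2, nu 3 ^ 2 * nu 5 ^ 3} :
      Multiset ℂ).map fun w => nu 7 ^ 4 * w) +
  (({-nu 5, -(nu 5 ^ 2), -(nu 5 ^ 3), -(nu 5 ^ 4), -(nu 5 ^ 4), -(nu 3 ^ 2 * nu 5 ^ 4)} :
      Multiset ℂ).map fun w => nu 7 ^ 6 * w)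

section CyclotomicCoefficients

open IntermediateField

/-- The powers `ζ ^ i`, `i < q`, of a primitive root of unity of prime order `q + 1` are linearly
independent over `ℚ(ξ)` when `ξ` is a root of unity of order prime to `q + 1`. -/
theorem IsPrimitiveRoot.linearIndependent_pow_of_coprime {L : Type*} [Field L] [CharZero L]
    {q m : ℕ} [NeZero m] (hq : (q + 1).Prime) (hm : m.Coprime (q + 1)) {ξ ζ : L}
    (hξ : IsPrimitiveRoot ξ m) (hζ : IsPrimitiveRoot ζ (q + 1)) :
    LinearIndependent ℚ⟮ξ⟯ fun i : Fin q => ζ ^ (i : ℕ) := by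
  have cyc {n : ℕ} [NeZero n] {μ : L} (hμ : IsPrimitiveRoot μ n) :
      IsCyclotomicExtension {n} ℚ ℚ⟮μ⟯ := by
    change IsCyclotomicExtension {n} ℚ ℚ⟮μ⟯.toSubalgebra
    rw [adjoin_simple_toSubalgebra_of_isAlgebraic
      (hμ.isIntegral (NeZero.pos n)).tower_top.isAlgebraic]
    exact hμ.adjoin_isCyclotomicExtension ℚ
  have h₁ := cyc hξ
  have h₂ := cyc hζ
  have h₁₂ : IsCyclotomicExtension {m * (q + 1)} ℚ ↥(ℚ⟮ξ⟯ ⊔ ℚ⟮ζ⟯) := by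
    rw [← hm.lcm_eq_mul]
    exact isCyclotomicExtension_lcm_sup (h₁ := h₁) (h₂ := h₂) ..
  have := IsCyclotomicExtension.finite_of_singleton m ℚ ℚ⟮ξ⟯
  have := IsCyclotomicExtension.finite_of_singleton (q + 1) ℚ ℚ⟮ζ⟯
  have : NeZero (m * (q + 1)) := ⟨mul_ne_zero (NeZero.ne m) q.succ_ne_zero⟩
  have disj : ℚ⟮ξ⟯.LinearDisjoint ℚ⟮ζ⟯ := by
    apply LinearDisjoint.of_finrank_sup
    rw [IsCyclotomicExtension.Rat.finrank (m * (q + 1)), IsCyclotomicExtension.Rat.finrank m,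
      IsCyclotomicExtension.Rat.finrank (q + 1), Nat.totient_mul hm]
  have rat : LinearIndependent ℚ fun i : Fin q => AdjoinSimple.gen ℚ ζ ^ (i : ℕ) := by
    rw [Fintype.linearIndependent_iff]
    intro c hc i
    have hc' := congrArg (algebraMap ℚ⟮ζ⟯ L) hc
    have key := (hζ.sum_eq_zero_iff_forall_eq hq (Fin.snoc c 0)).1 (by
      rw [Fin.sum_univ_castSucc]
      simpa [Algebra.smul_def] using hc') i.castSucc (Fin.last q)
    simpa using key
  simpa [Function.comp_def] using disj.linearIndependent_right' rat

theorem IsPrimitiveRoot.eq_of_sum_mul_pow_eq_zero {L : Type*} [Field L] [CharZero L]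
    {q m : ℕ} [NeZero m] (hq : (q + 1).Prime) (hm : m.Coprime (q + 1)) {ξ ζ : L}
    (hξ : IsPrimitiveRoot ξ m) (hζ : IsPrimitiveRoot ζ (q + 1)) {x : Fin (q + 1) → L}
    (hx : ∀ i, x i ∈ ℚ⟮ξ⟯) (h : ∑ i, x i * ζ ^ (i : ℕ) = 0) (i j : Fin (q + 1)) :
    x i = x j := by
  have geom : ∑ i : Fin (q + 1), ζ ^ (i : ℕ) = 0 := by
    rw [Fin.sum_univ_eq_sum_range (fun i => ζ ^ i)]
    exact hζ.geom_sum_eq_zero hq.one_lt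
  have ind := hξ.linearIndependent_pow_of_coprime hq hm hζ
  rw [Fintype.linearIndependent_iff] at ind
  lift x to Fin (q + 1) → ℚ⟮ξ⟯ using hx
  suffices key : ∀ i : Fin q, x i.castSucc - x (Fin.last q) = 0 by
    have last (i : Fin (q + 1)) : x i = x (Fin.last q) :=
      Fin.lastCases rfl (fun i => sub_eq_zero.1 (key i)) i
    exact congrArg _ ((last i).trans (last j).symm)
  refine ind _ ?_
  rw [Fin.sum_univ_castSucc] at h geom
  simp only [Fin.val_castSucc, Fin.val_last] at h geom
  simp only [IntermediateField.smul_def, smul_eq_mul, AddSubgroupClass.coe_sub, sub_mul,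
    Finset.sum_sub_distrib, ← Finset.mul_sum]
  linear_combination h - (x (Fin.last q) : L) * geom

end CyclotomicCoefficients

theorem nu_isPrimitiveRoot {n : ℕ} (hn : n ≠ 0) : IsPrimitiveRoot (nu n) n :=
  Complex.isPrimitiveRoot_exp n hn

theorem nu_mul_pow {m n : ℕ} (hm : m ≠ 0) : nu (m * n) ^ m = nu n := by
  rw [nu, nu, ← Complex.exp_nat_mul]
  congr 1
  push_cast
  field_simp

theorem nu_pow_eq_of_modEq {n a b : ℕ} (hn : n ≠ 0) (h : a ≡ b [MOD n]) : nu n ^ a = nu n ^ b :=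
  pow_eq_pow_of_modEq h (nu_isPrimitiveRoot hn).pow_eq_one

/-- The exponents of `stmt10Sorou` with respect to `nu 210`. -/
def sorouExponents : Multiset ℕ :=
  {0, 28, 30, 58, 60, 88, 90, 118, 150, 178, 85, 183, 92, 134, 176, 117, 159, 201, 33, 33, 173}

theorem count_sorouExponents :
    ∀ x ∈ sorouExponents, sorouExponents.count x = if x = 33 then 2 else 1 := by
  decide

theorem nu_three_eq : nu 3 = nu 210 ^ 70 := (nu_mul_pow (m := 70) (n := 3) (by norm_num)).symm
theorem nu_five_eq : nu 5 = nu 210 ^ 42 := (nu_mul_pow (m := 42) (n := 5) (by norm_num)).symm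
theorem nu_seven_eq : nu 7 = nu 210 ^ 30 := (nu_mul_pow (m := 30) (n := 7) (by norm_num)).symm

theorem nu_210_pow_half : nu 210 ^ 105 = -1 := by
  rw [nu_mul_pow (m := 105) (n := 2) (by norm_num)]
  exact (nu_isPrimitiveRoot two_ne_zero).eq_neg_one_of_two_right

theorem stmt10Sorou_eq_map : stmt10Sorou = sorouExponents.map (nu 210 ^ ·) := by
  have red {a b : ℕ} (h : a % 210 = b) : nu 210 ^ a = nu 210 ^ b :=
    nu_pow_eq_of_modEq (by norm_num) (by subst h; exact (Nat.mod_modEq a 210).symm)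
  have neg (z : ℂ) : -z = nu 210 ^ 105 * z := by rw [nu_210_pow_half, neg_one_mul]
  have reduced : sorouExponents =
      ({0, 238, 30, 268, 60, 298, 90, 328, 150, 388, 295, 393, 302, 344, 386,
        327, 369, 411, 453, 453, 593} : Multiset ℕ).map (· % 210) := by decide
  rw [reduced, Multiset.map_map]
  simp only [stmt10Sorou, nu_three_eq, nu_five_eq, nu_seven_eq, neg, Function.comp_def, ← red rfl,
    Multiset.insert_eq_cons, Multiset.cons_bind, Multiset.singleton_bind, Multiset.map_cons,
    Multiset.map_singleton, Multiset.cons_add, Multiset.singleton_add, ← pow_mul, ← pow_add,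
    mul_one, Nat.reduceMul, Nat.reduceAdd, pow_zero]

theorem one_add_nu_three_add_sq : 1 + nu 3 + nu 3 ^ 2 = 0 := by
  simpa [Finset.sum_range_succ] using
    (nu_isPrimitiveRoot three_ne_zero).geom_sum_eq_zero (by norm_num)

theorem geom_sum_nu_five : 1 + nu 5 + nu 5 ^ 2 + nu 5 ^ 3 + nu 5 ^ 4 = 0 := by
  simpa [Finset.sum_range_succ] using
    (nu_isPrimitiveRoot (n := 5) (by norm_num)).geom_sum_eq_zero (by norm_num)

theorem geom_sum_nu_seven :
    1 + nu 7 + nu 7 ^ 2 + nu 7 ^ 3 + nu 7 ^ 4 + nu 7 ^ 5 + nu 7 ^ 6 = 0 := by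
  simpa [Finset.sum_range_succ] using
    (nu_isPrimitiveRoot (n := 7) (by norm_num)).geom_sum_eq_zero (by norm_num)

theorem eq_of_add_mul_nu_three_eq_zero {a b c : ℤ}
    (h : (a : ℂ) + b * nu 3 + c * nu 3 ^ 2 = 0) : a = c ∧ b = c := by
  have key := ((nu_isPrimitiveRoot three_ne_zero).sum_eq_zero_iff_forall_eq_int Nat.prime_three
    ![a, b, c]).1 (by simpa [Fin.sum_univ_succ, add_assoc] using h)
  exact ⟨key 0 2, key 1 2⟩

/-- A sum of powers of `nu 210` supported on `sorouExponents`, sorted by powers of `nu 7`. -/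
theorem sum_sorouExponents (n : ℕ → ℂ) :
    ∑ x ∈ sorouExponents.toFinset, n x * nu 210 ^ x =
      ∑ i, ![n 0 + n 28 * (nu 3 * nu 5 ^ 4), n 30 + n 58 * (nu 3 * nu 5 ^ 4),
        n 60 + n 88 * (nu 3 * nu 5 ^ 4), n 90 + n 118 * (nu 3 * nu 5 ^ 4),
        -(n 85 * nu 3) - n 183 * nu 5 ^ 4 +
          nu 3 ^ 2 * (n 92 * nu 5 + n 134 * nu 5 ^ 2 + n 176 * nu 5 ^ 3),
        n 150 + n 178 * (nu 3 * nu 5 ^ 4),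
        -(n 117 * nu 5 + n 159 * nu 5 ^ 2 + n 201 * nu 5 ^ 3 + n 33 * nu 5 ^ 4) -
          n 173 * (nu 3 ^ 2 * nu 5 ^ 4)] i * nu 7 ^ (i : ℕ) := by
  have mono (a b c d k : ℕ) (h : 105 * a + 70 * b + 42 * c + 30 * d ≡ k [MOD 210]) :
      nu 210 ^ k = (-1) ^ a * nu 3 ^ b * nu 5 ^ c * nu 7 ^ d := by
    rw [← nu_pow_eq_of_modEq (by norm_num) h, nu_three_eq, nu_five_eq, nu_seven_eq,
      ← nu_210_pow_half]
    ring
  have support : sorouExponents.toFinset =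
      {0, 28, 30, 58, 60, 88, 90, 118, 150, 178, 85, 183, 92, 134, 176, 117, 159, 201, 33, 173} := by
    decide
  rw [support]
  iterate 19 rw [Finset.sum_insert (by decide)]
  rw [Finset.sum_singleton, mono 0 1 4 0 28 rfl, mono 0 0 0 1 30 rfl, mono 0 1 4 1 58 rfl,
    mono 0 0 0 2 60 rfl, mono 0 1 4 2 88 rfl, mono 0 0 0 3 90 rfl, mono 0 1 4 3 118 rfl,
    mono 0 0 0 5 150 rfl, mono 0 1 4 5 178 rfl, mono 1 1 0 4 85 rfl, mono 1 0 4 4 183 rfl,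
    mono 0 2 1 4 92 rfl, mono 0 2 2 4 134 rfl, mono 0 2 3 4 176 rfl, mono 1 0 1 6 117 rfl,
    mono 1 0 2 6 159 rfl, mono 1 0 3 6 201 rfl, mono 1 0 4 6 33 rfl, mono 1 2 4 6 173 rfl]
  simp [Fin.sum_univ_succ]
  ring

theorem sum_map_nu_pow {T : Multiset ℕ} (hT : T ≤ sorouExponents) :
    (T.map (nu 210 ^ ·)).sum =
      ∑ x ∈ sorouExponents.toFinset, (T.count x : ℂ) * nu 210 ^ x := by
  rw [Finset.sum_multiset_map_count]
  simp only [nsmul_eq_mul]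
  exact Finset.sum_subset (Multiset.toFinset_subset.2 (Multiset.subset_of_le hT))
    fun x _ hx => by simp [Multiset.count_eq_zero.2 (mt Multiset.mem_toFinset.2 hx)]

theorem sum_stmt10Sorou : stmt10Sorou.sum = 0 := by
  rw [stmt10Sorou_eq_map, sum_map_nu_pow le_rfl, Finset.sum_congr rfl fun x hx => by
    rw [count_sorouExponents x (Multiset.mem_toFinset.1 hx)],
    sum_sorouExponents fun x => ((if x = 33 then 2 else 1 : ℕ) : ℂ)]
  simp [Fin.sum_univ_succ]
  linear_combination (1 + nu 3 * nu 5 ^ 4) * geom_sum_nu_seven +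
    (nu 7 ^ 4 * nu 3 ^ 2 - nu 7 ^ 6) * geom_sum_nu_five -
    (nu 7 ^ 4 * (1 + nu 5 ^ 4) + nu 7 ^ 6 * nu 5 ^ 4) * one_add_nu_three_add_sq

theorem Multiset.exists_le_map_eq_of_le_map {α β : Type*} {f : α → β} {s : Multiset α}
    {t : Multiset β} (h : t ≤ s.map f) : ∃ u ≤ s, u.map f = t := by
  classical
  induction s using Multiset.induction_on generalizing t with
  | empty => exact ⟨0, le_rfl, (Multiset.le_zero.1 (by simpa using h)).symm⟩
  | cons a s ih =>
    rw [Multiset.map_cons] at h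
    by_cases ha : f a ∈ t
    · obtain ⟨t, rfl⟩ := Multiset.exists_cons_of_mem ha
      obtain ⟨u, hu, rfl⟩ := ih ((Multiset.cons_le_cons_iff _).1 h)
      exact ⟨a ::ₘ u, Multiset.cons_le_cons a hu, Multiset.map_cons f a u⟩
    · obtain ⟨u, hu, rfl⟩ := ih ((Multiset.le_cons_of_notMem ha).1 h)
      exact ⟨u, hu.trans (Multiset.le_cons_self s a), rfl⟩

open IntermediateField in
/-- A vanishing integer combination of powers of `nu 210` with exponents in `sorouExponents` has
coefficients proportional to the multiplicities. -/
theorem coeff_eq_of_sum_eq_zero {n : ℕ → ℕ}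
    (h : ∑ x ∈ sorouExponents.toFinset, (n x : ℂ) * nu 210 ^ x = 0) :
    ∀ x ∈ sorouExponents, n x = n 0 * sorouExponents.count x := by
  rw [sum_sorouExponents (fun x => (n x : ℂ))] at h
  have three : nu 3 ∈ ℚ⟮nu 15⟯ := by
    rw [← nu_mul_pow (m := 5) (n := 3) (by norm_num)]
    exact pow_mem (mem_adjoin_simple_self ℚ _) 5
  have five : nu 5 ∈ ℚ⟮nu 15⟯ := by
    rw [← nu_mul_pow (m := 3) (n := 5) (by norm_num)]
    exact pow_mem (mem_adjoin_simple_self ℚ _) 3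
  have cast (k : ℕ) : (k : ℂ) ∈ ℚ⟮nu 15⟯ := _root_.natCast_mem _ k
  have blocks := (nu_isPrimitiveRoot (n := 15) (by norm_num)).eq_of_sum_mul_pow_eq_zero
    (q := 6) (by norm_num) (by norm_num) (nu_isPrimitiveRoot (by norm_num)) (by
      intro i
      fin_cases i <;> dsimp <;>
        repeat' first
          | exact cast _
          | exact pow_mem three _
          | exact pow_mem five _
          | exact three
          | exact five
          | apply add_mem
          | apply sub_mem
          | apply neg_mem
          | apply mul_mem) h
  have mem (a b c : ℤ) : (a : ℂ) + b * nu 3 + c * nu 3 ^ 2 ∈ ℚ⟮nu 3⟯ :=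
    have gen := mem_adjoin_simple_self ℚ (nu 3)
    add_mem (add_mem (intCast_mem _ a) (mul_mem (intCast_mem _ b) gen))
      (mul_mem (intCast_mem _ c) (pow_mem gen 2))
  have basis (a b c : Fin 5 → ℤ)
      (h : ∑ i, ((a i : ℂ) + b i * nu 3 + c i * nu 3 ^ 2) * nu 5 ^ (i : ℕ) = 0) (i j : Fin 5) :
      a i - a j = c i - c j ∧ b i - b j = c i - c j := by
    have key := (nu_isPrimitiveRoot three_ne_zero).eq_of_sum_mul_pow_eq_zero (q := 4)
      (by norm_num) (by norm_num) (nu_isPrimitiveRoot (by norm_num))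
      (fun i => mem (a i) (b i) (c i)) h i j
    apply eq_of_add_mul_nu_three_eq_zero
    push_cast
    linear_combination key
  have pair (a b : ℕ) (h : (a : ℂ) + b * (nu 3 * nu 5 ^ 4) =
      n 0 + n 28 * (nu 3 * nu 5 ^ 4)) : a = n 0 ∧ b = n 28 := by
    have key := basis ![a - n 0, 0, 0, 0, 0] ![0, 0, 0, 0, b - n 28] ![0, 0, 0, 0, 0] (by
      simp [Fin.sum_univ_succ]
      linear_combination h)
    have k1 := key 0 1
    have k2 := key 4 1
    simp at k1 k2
    omega
  have b1 := pair _ _ (blocks 1 0)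
  have b2 := pair _ _ (blocks 2 0)
  have b3 := pair _ _ (blocks 3 0)
  have b5 := pair _ _ (blocks 5 0)
  have b4 := basis ![-n 0, 0, 0, 0, -n 183] ![-n 85, 0, 0, 0, -n 28] ![0, n 92, n 134, n 176, 0] (by
    have := blocks 4 0
    simp at this
    simp [Fin.sum_univ_succ]
    linear_combination this)
  have b6 := basis ![-n 0, -n 117, -n 159, -n 201, -n 33] ![0, 0, 0, 0, -n 28]
    ![0, 0, 0, 0, -n 173] (by
    have := blocks 6 0
    simp at this
    simp [Fin.sum_univ_succ]
    linear_combination this)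
  have b41 := b4 0 1
  have b42 := b4 2 1
  have b43 := b4 3 1
  have b44 := b4 4 1
  have b61 := b6 1 0
  have b62 := b6 2 0
  have b63 := b6 3 0
  have b64 := b6 4 0
  simp at b41 b42 b43 b44 b61 b62 b63 b64
  intro x hx
  rw [count_sorouExponents x hx]
  simp only [sorouExponents, Multiset.insert_eq_cons, Multiset.mem_cons,
    Multiset.mem_singleton] at hx
  rcases hx with rfl | rfl | rfl | rfl | rfl | rfl | rfl | rfl | rfl | rfl | rfl | rfl | rfl |
    rfl | rfl | rfl | rfl | rfl | rfl | rfl | rfl <;> simp <;> omega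

theorem stmt10Sorou_isMinVanishing : IsMinVanishing stmt10Sorou := by
  refine ⟨sum_stmt10Sorou, fun g hg hg0 hgh hsum => ?_⟩
  rw [stmt10Sorou_eq_map] at hg hgh
  obtain ⟨T, hT, rfl⟩ := Multiset.exists_le_map_eq_of_le_map hg
  rw [sum_map_nu_pow hT] at hsum
  have coeff := coeff_eq_of_sum_eq_zero hsum
  have count (x : ℕ) : T.count x = T.count 0 * sorouExponents.count x := by
    by_cases hx : x ∈ sorouExponents
    · exact coeff x hx
    · rw [Multiset.count_eq_zero.2 hx, Multiset.count_eq_zero.2 (mt (Multiset.mem_of_le hT) hx),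
        mul_zero]
  have le_one : T.count 0 ≤ 1 := Multiset.count_le_of_le 0 hT
  rcases Nat.le_one_iff_eq_zero_or_eq_one.1 le_one with h | h
  · exact hg0 (by rw [show T = 0 from Multiset.ext.2 fun x => by simp [count x, h]]; rfl)
  · exact hgh (by rw [show T = sorouExponents from Multiset.ext.2 fun x => by simp [count x, h]])

theorem count_stmt10Sorou {x : ℕ} (hx : x ∈ sorouExponents) :
    stmt10Sorou.count (nu 210 ^ x) = sorouExponents.count x := by
  rw [stmt10Sorou_eq_map]
  have lt : ∀ y ∈ sorouExponents, y < 210 := by decide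
  exact Multiset.count_map_eq_count _ sorouExponents (fun a ha b hb hab =>
    (nu_isPrimitiveRoot (by norm_num)).pow_inj (lt a ha) (lt b hb) hab) x hx

theorem stmt_10 :
    IsSorou stmt10Sorou ∧ IsMinVanishing stmt10Sorou ∧
    Multiset.card stmt10Sorou = 21 ∧
    (∀ w : ℂ, stmt10Sorou.count w ≤ 2) ∧ (∃ z : ℂ, stmt10Sorou.count z = 2) := by
  refine ⟨⟨?_, fun z hz => ?_⟩, stmt10Sorou_isMinVanishing, ?_, fun w => ?_, ?_⟩
  · rw [stmt10Sorou_eq_map, sorouExponents, Multiset.insert_eq_cons, Multiset.map_cons]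
    exact Multiset.cons_ne_zero
  · rw [stmt10Sorou_eq_map, Multiset.mem_map] at hz
    obtain ⟨k, -, rfl⟩ := hz
    refine ⟨210, by norm_num, ?_⟩
    rw [pow_right_comm, (nu_isPrimitiveRoot (by norm_num)).pow_eq_one, one_pow]
  · rw [stmt10Sorou_eq_map, Multiset.card_map]
    rfl
  · by_cases hw : w ∈ stmt10Sorou
    · obtain ⟨k, hk, rfl⟩ := Multiset.mem_map.1 (stmt10Sorou_eq_map ▸ hw)
      rw [count_stmt10Sorou hk, count_sorouExponents k hk]
      split_ifs <;> norm_num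
    · rw [Multiset.count_eq_zero.2 hw]
      norm_num
  · exact ⟨nu 210 ^ 33, count_stmt10Sorou (by decide)⟩
end

section
/- There is no minimal vanishing sorou of weight 4: if h is a multiset of 4 roots of unity whose elements sum to 0, then some nonempty proper sub-multiset of h also has sum 0. -/
open Complex

theorem IsRootOfUnity.mul_conj {z : ℂ} (hz : IsRootOfUnity z) :
    z * (starRingEnd ℂ) z = 1 := by
  obtain ⟨n, hn, hz⟩ := hz
  rw [Complex.mul_conj, Complex.normSq_eq_norm_sq,
    Complex.norm_eq_one_of_pow_eq_one hz hn.ne']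
  norm_num

/-- If four complex numbers on the unit circle sum to zero, then the first is the negative of
another one. -/
theorem add_eq_zero_of_sum_four_eq_zero {a b c d : ℂ}
    (ha : a * (starRingEnd ℂ) a = 1) (hb : b * (starRingEnd ℂ) b = 1)
    (hc : c * (starRingEnd ℂ) c = 1) (hd : d * (starRingEnd ℂ) d = 1)
    (h : a + b + c + d = 0) : a + b = 0 ∨ a + c = 0 ∨ a + d = 0 := by
  have hconj := congrArg (starRingEnd ℂ) h
  simp only [map_add, map_zero] at hconj
  have key : (a + b) * ((a + c) * (a + d)) = 0 := by
    linear_combination a ^ 2 * h + a * b * c * d * hconj - b * c * d * ha -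
      a * c * d * hb - a * b * d * hc - a * b * c * hd
  simpa only [mul_eq_zero] using key

theorem stmt_11 (h : Multiset ℂ) (hroots : ∀ z ∈ h, IsRootOfUnity z)
    (hcard : Multiset.card h = 4) (hvan : h.sum = 0) :
    ∃ g : Multiset ℂ, g ≤ h ∧ g ≠ 0 ∧ g ≠ h ∧ g.sum = 0 := by
  obtain ⟨a, b, c, d, rfl⟩ := Multiset.card_eq_four.mp hcard
  have hunit : ∀ z ∈ ({a, b, c, d} : Multiset ℂ), z * (starRingEnd ℂ) z = 1 :=
    fun z hz => (hroots z hz).mul_conj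
  have of_pair : ∀ x : ℂ, ({a, x} : Multiset ℂ) ≤ {a, b, c, d} → a + x = 0 →
      ∃ g : Multiset ℂ, g ≤ {a, b, c, d} ∧ g ≠ 0 ∧ g ≠ {a, b, c, d} ∧ g.sum = 0 := by
    refine fun x hle hx => ⟨{a, x}, hle, by simp, fun heq => ?_, by simpa using hx⟩
    simpa using congrArg Multiset.card heq
  have hsum : a + b + c + d = 0 := by simpa [add_assoc] using hvan
  rcases add_eq_zero_of_sum_four_eq_zero (hunit a (by simp)) (hunit b (by simp))
    (hunit c (by simp)) (hunit d (by simp)) hsum with hx | hx | hx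
  · exact of_pair b (Multiset.cons_le_cons _ (by simp)) hx
  · exact of_pair c (Multiset.cons_le_cons _ (by simp)) hx
  · exact of_pair d (Multiset.cons_le_cons _ (by simp)) hx
end

section
/- Every minimal vanishing sorou of weight 2 is of the form {z, −z} for some root of unity z; every minimal vanishing sorou of weight 3 is a rotation of {1, ν_3, ν_3^2}; and every minimal vanishing sorou of weight 5 is a rotation of {1, ν_5, ν_5^2, ν_5^3, ν_5^4}. -/
open Complex

namespace IsRootOfUnity

lemma norm_eq_one_s12 {z : ℂ} (hz : IsRootOfUnity z) : ‖z‖ = 1 := by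
  obtain ⟨n, hn, h⟩ := hz
  exact Complex.norm_eq_one_of_pow_eq_one h hn.ne'

lemma inv {z : ℂ} (hz : IsRootOfUnity z) : IsRootOfUnity z⁻¹ := by
  obtain ⟨n, hn, h⟩ := hz
  exact ⟨n, hn, by simp [h]⟩

lemma mul {z w : ℂ} (hz : IsRootOfUnity z) (hw : IsRootOfUnity w) : IsRootOfUnity (z * w) := by
  obtain ⟨n, hn, h⟩ := hz
  obtain ⟨m, hm, k⟩ := hw
  refine ⟨n * m, Nat.mul_pos hn hm, ?_⟩
  rw [mul_pow, pow_mul, h, mul_comm n m, pow_mul, k, one_pow, one_pow, one_mul]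

end IsRootOfUnity

lemma exists_common_exponent (h : Multiset ℂ) (hh : ∀ z ∈ h, IsRootOfUnity z) :
    ∃ n : ℕ, 0 < n ∧ ∀ z ∈ h, z ^ n = 1 := by
  induction h using Multiset.induction_on with
  | empty => exact ⟨1, one_pos, by simp⟩
  | cons a s ih =>
    obtain ⟨n, hn, h₁⟩ := ih fun z hz => hh z (Multiset.mem_cons_of_mem hz)
    obtain ⟨m, hm, h₂⟩ := hh a (Multiset.mem_cons_self a s)
    refine ⟨n * m, Nat.mul_pos hn hm, fun z hz => ?_⟩
    rcases Multiset.mem_cons.1 hz with rfl | hz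
    · rw [mul_comm, pow_mul, h₂, one_pow]
    · rw [pow_mul, h₁ z hz, one_pow]

/-- A vanishing sum of `n`-th roots of unity still vanishes after raising all of its terms to a
power coprime to `n`. -/
lemma sum_map_pow_eq_zero {h : Multiset ℂ} {n k : ℕ} (hn : 0 < n) (hk : k.Coprime n)
    (hh : ∀ z ∈ h, z ^ n = 1) (h0 : h.sum = 0) : (h.map (· ^ k)).sum = 0 := by
  have hζ := Complex.isPrimitiveRoot_exp n hn.ne'
  set ζ := Complex.exp (2 * Real.pi * Complex.I / n)
  have : NeZero n := ⟨hn.ne'⟩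
  have key : ∀ z : ℂ, ∃ i : ℕ, z ^ n = 1 → ζ ^ i = z := fun z => by
    by_cases hz : z ^ n = 1
    · obtain ⟨i, -, hi⟩ := hζ.eq_pow_of_pow_eq_one hz
      exact ⟨i, fun _ => hi⟩
    · exact ⟨0, fun h' => absurd h' hz⟩
  choose e he using key
  let f : Polynomial ℤ := (h.map fun z => Polynomial.X ^ e z).sum
  have hf (x : ℂ) : Polynomial.aeval x f = (h.map fun z => x ^ e z).sum := by
    simp [f, map_multiset_sum, Multiset.map_map]
  have hfζ : Polynomial.aeval ζ f = 0 := by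
    rw [hf, Multiset.map_congr rfl fun z hz => he z (hh z hz), Multiset.map_id', h0]
  have hdvd := minpoly.isIntegrallyClosed_dvd (hζ.isIntegral hn) hfζ
  rw [hζ.minpoly_eq_pow_coprime hk] at hdvd
  have hfk : Polynomial.aeval (ζ ^ k) f = 0 := by
    obtain ⟨q, hq⟩ := hdvd
    rw [hq, map_mul, minpoly.aeval, zero_mul]
  rw [hf] at hfk
  rw [← hfk]
  refine congrArg _ (Multiset.map_congr rfl fun z hz => ?_)
  rw [← pow_mul, mul_comm, pow_mul, he z (hh z hz)]

lemma sum_map_inv_eq_star {h : Multiset ℂ} (hh : ∀ z ∈ h, ‖z‖ = 1) :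
    (h.map (·⁻¹)).sum = starRingEnd ℂ h.sum := by
  rw [map_multiset_sum]
  exact congrArg _ (Multiset.map_congr rfl fun z hz => Complex.inv_eq_conj (hh z hz))

lemma sum_add_pow_succ_eq {m : ℕ} (h : Multiset ℂ) (hh : ∀ z ∈ h, z ^ m = 1 ∨ z ^ m = -1) :
    (h.map fun z => z + z ^ (1 + m)).sum = 2 * (h.filter fun z => z ^ m = 1).sum := by
  induction h using Multiset.induction_on with
  | empty => simp
  | cons a s ih =>
    rw [Multiset.map_cons, Multiset.sum_cons,
      ih fun z hz => hh z (Multiset.mem_cons_of_mem hz)]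
    rcases hh a (Multiset.mem_cons_self a s) with ha | ha
    · rw [Multiset.filter_cons_of_pos (p := fun z => z ^ m = 1) _ ha, Multiset.sum_cons, pow_add, ha]
      ring
    · have hne : ¬ a ^ m = 1 := by rw [ha]; norm_num
      rw [Multiset.filter_cons_of_neg (p := fun z => z ^ m = 1) _ hne, pow_add, ha]
      ring

namespace IsMinVanishing

lemma map_mul {h : Multiset ℂ} (hm : IsMinVanishing h) {c : ℂ} (hc : c ≠ 0) :
    IsMinVanishing (h.map (c * ·)) := by
  refine ⟨by rw [Multiset.sum_map_mul_left, Multiset.map_id', hm.1, mul_zero],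
    fun g hg g0 gne hs => ?_⟩
  have hcancel (s : Multiset ℂ) {d : ℂ} (hd : d ≠ 0) : (s.map (d⁻¹ * ·)).map (d * ·) = s := by
    simp [Multiset.map_map, hd]
  have hcancel' (s : Multiset ℂ) : (s.map (c * ·)).map (c⁻¹ * ·) = s := by
    simp [Multiset.map_map, hc]
  refine hm.2 (g.map (c⁻¹ * ·)) ?_ (by simpa using g0) ?_ ?_
  · rw [← hcancel' h]
    exact Multiset.map_le_map hg
  · rintro rfl
    exact gne (hcancel g hc).symm
  · rw [Multiset.sum_map_mul_left, Multiset.map_id', hs, mul_zero]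

lemma add_ne_zero {h t : Multiset ℂ} {x y : ℂ} (hm : IsMinVanishing h)
    (hh : h = {x, y} + t) (ht : t ≠ 0) : x + y ≠ 0 := by
  have := hm.2 {x, y} (by rw [hh]; exact Multiset.le_add_right _ _) (by simp)
    (fun h' => ht (by simpa [← h'] using hh))
  simpa using this

/-- In a minimal vanishing sum of roots of unity containing `1`, all orders divide some `2 * m`
with `m` odd. -/
lemma exists_odd_exponent {h : Multiset ℂ} (hm : IsMinVanishing h) (h1 : (1 : ℂ) ∈ h) (n : ℕ)
    (hn : 0 < n) (hh : ∀ z ∈ h, z ^ n = 1) : ∃ m : ℕ, Odd m ∧ ∀ z ∈ h, z ^ (2 * m) = 1 := by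
  induction n using Nat.strong_induction_on with
  | _ n ih =>
    rcases Nat.even_or_odd' n with ⟨m, rfl | hodd⟩
    swap
    · exact ⟨n, ⟨m, hodd⟩, fun z hz => by rw [mul_comm, pow_mul, hh z hz, one_pow]⟩
    rcases Nat.even_or_odd m with hev | hodd
    swap
    · exact ⟨m, hodd, hh⟩
    have hcop : (1 + m).Coprime (2 * m) :=
      Nat.Coprime.mul_right (Nat.coprime_two_right.2 (by simpa [add_comm] using hev.add_one))
        (by simp)
    have hs := sum_map_pow_eq_zero hn hcop hh hm.1
    have hsum : (h.map fun z => z + z ^ (1 + m)).sum = 0 := by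
      rw [Multiset.sum_map_add, Multiset.map_id', hm.1, hs, add_zero]
    classical
    have hfil := sum_add_pow_succ_eq (m := m) h fun z hz => by
      rw [← sq_eq_one_iff, ← pow_mul, mul_comm, hh z hz]
    have hfeq : h.filter (fun z => z ^ m = 1) = h := by
      by_contra hne
      refine hm.2 _ (Multiset.filter_le _ h) ?_ hne ?_
      · intro h0
        have : (1 : ℂ) ∈ h.filter fun z => z ^ m = 1 := by simp [h1]
        simp [h0] at this
      · simpa [hfil] using hsum
    exact ih m (by omega) (by omega) (Multiset.filter_eq_self.1 hfeq)

end IsMinVanishing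

lemma eq_of_prod_X_sub_C {h : Multiset ℂ} {n : ℕ} {c a : ℂ} (hn : 0 < n) (ha : a ∈ h)
    (hp : (h.map fun z => Polynomial.X - Polynomial.C z).prod
      = Polynomial.X ^ n - Polynomial.C c) :
    h = (Multiset.range n).map fun i => a * nu n ^ i := by
  have hroots := Polynomial.roots_multiset_prod_X_sub_C h
  rw [hp] at hroots
  have hac : a ^ n = c := by
    have hmem := ha
    rw [← hroots] at hmem
    have := (Polynomial.mem_roots'.1 hmem).2
    simpa [sub_eq_zero] using this
  have hν : IsPrimitiveRoot (nu n) n := Complex.isPrimitiveRoot_exp n hn.ne'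
  have := hν.nthRoots_eq hac
  rw [Polynomial.nthRoots, hroots] at this
  simpa [mul_comm] using this

lemma weight_three {h : Multiset ℂ} (hs : h.sum = 0) (hnorm : ∀ z ∈ h, ‖z‖ = 1)
    (hcard : Multiset.card h = 3) :
    ∃ z ∈ h, h = ({z, z * nu 3, z * nu 3 ^ 2} : Multiset ℂ) := by
  obtain ⟨a, b, c, rfl⟩ := Multiset.card_eq_three.1 hcard
  have hi := sum_map_inv_eq_star hnorm
  rw [hs, map_zero] at hi
  have ne {z : ℂ} (hz : ‖z‖ = 1) : z ≠ 0 := by rintro rfl; simp at hz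
  have ha := ne (hnorm a (by simp))
  have hb := ne (hnorm b (by simp))
  have hc := ne (hnorm c (by simp))
  simp only [Multiset.insert_eq_cons, Multiset.map_cons, Multiset.sum_cons,
    Multiset.map_singleton, Multiset.sum_singleton] at hi hs
  field_simp at hi
  have h1 := congrArg Polynomial.C hs
  have h2 := congrArg Polynomial.C hi
  simp only [map_add, map_mul, map_zero] at h1 h2
  have := eq_of_prod_X_sub_C (n := 3) (c := a * b * c) (a := a) (h := {a, b, c}) (by simp)
    (by simp) (by
      simp only [Multiset.insert_eq_cons, Multiset.map_cons, Multiset.prod_cons,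
        Multiset.map_singleton, Multiset.prod_singleton, map_mul]
      linear_combination (-Polynomial.X ^ 2) * h1 + Polynomial.X * h2)
  refine ⟨a, by simp, this.trans ?_⟩
  rw [← Multiset.coe_range]
  simp [List.range_succ]
  rfl

/-- A vanishing sum of five complex numbers of modulus one whose squares also sum to zero is a
rotated regular pentagon. -/
lemma weight_five_of_sum_sq {h : Multiset ℂ} (hs : h.sum = 0) (hnorm : ∀ z ∈ h, ‖z‖ = 1)
    (hsq : (h.map (· ^ 2)).sum = 0) (hcard : Multiset.card h = 5) :
    ∃ z ∈ h, h = ({z, z * nu 5, z * nu 5 ^ 2, z * nu 5 ^ 3, z * nu 5 ^ 4} : Multiset ℂ) := by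
  obtain ⟨a, t, rfl, ht⟩ := Multiset.card_eq_succ_iff.1 hcard
  obtain ⟨b, c, d, e, rfl⟩ := Multiset.card_eq_four.1 ht
  have hi := sum_map_inv_eq_star hnorm
  rw [hs, map_zero] at hi
  have hi2 := sum_map_inv_eq_star (h := (a ::ₘ {b, c, d, e}).map (· ^ 2)) fun z hz => by
    obtain ⟨w, hw, rfl⟩ := Multiset.mem_map.1 hz
    rw [norm_pow, hnorm w hw, one_pow]
  rw [hsq, map_zero, Multiset.map_map] at hi2
  have ne {z : ℂ} (hz : ‖z‖ = 1) : z ≠ 0 := by rintro rfl; simp at hz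
  have ha := ne (hnorm a (by simp))
  have hb := ne (hnorm b (by simp))
  have hc := ne (hnorm c (by simp))
  have hd := ne (hnorm d (by simp))
  have he := ne (hnorm e (by simp))
  simp only [Multiset.insert_eq_cons, Multiset.map_cons, Multiset.sum_cons,
    Multiset.map_singleton, Multiset.sum_singleton, Function.comp_apply, ← inv_pow]
    at hi hs hsq hi2
  have key {a b c d e : ℂ} (h1 : a + (b + (c + (d + e))) = 0)
      (h2 : a ^ 2 + (b ^ 2 + (c ^ 2 + (d ^ 2 + e ^ 2))) = 0) :
      a * b + a * c + a * d + a * e + b * c + b * d + b * e + c * d + c * e + d * e = 0 := by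
    linear_combination (1 / 2) * (a + b + c + d + e) * h1 - (1 / 2) * h2
  have hq := congrArg Polynomial.C (key hs hsq)
  have hr := key hi hi2
  have h3 : a * b * c + a * b * d + a * b * e + a * c * d + a * c * e + a * d * e + b * c * d
      + b * c * e + b * d * e + c * d * e = 0 := by
    field_simp at hr
    linear_combination hr
  field_simp at hi
  replace hs := congrArg Polynomial.C hs
  replace h3 := congrArg Polynomial.C h3
  replace hi := congrArg Polynomial.C hi
  simp only [map_add, map_mul, map_zero] at hs hq h3 hi
  have := eq_of_prod_X_sub_C (n := 5) (c := a * b * c * d * e) (a := a)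
    (h := a ::ₘ {b, c, d, e}) (by simp) (by simp) (by
      simp only [Multiset.insert_eq_cons, Multiset.map_cons, Multiset.prod_cons,
        Multiset.map_singleton, Multiset.prod_singleton, map_mul]
      linear_combination (-Polynomial.X ^ 4) * hs + Polynomial.X ^ 3 * hq
        - Polynomial.X ^ 2 * h3 + Polynomial.X * hi)
  refine ⟨a, by simp, this.trans ?_⟩
  rw [← Multiset.coe_range]
  simp [List.range_succ]
  rfl

lemma exists_add_eq_zero_of_four_one {a b c d e : ℂ} (ha : a ≠ 0) (hb : b ≠ 0) (hc : c ≠ 0)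
    (hd : d ≠ 0) (he : e ≠ 0) (h1 : a + b + c + d + e = 0)
    (hi : a⁻¹ + b⁻¹ + c⁻¹ + d⁻¹ + e⁻¹ = 0) (h2 : a ^ 2 + b ^ 2 + c ^ 2 + d ^ 2 = e ^ 2) :
    a + e = 0 ∨ b + e = 0 ∨ c + e = 0 ∨ d + e = 0 := by
  have hq : a * b + a * c + a * d + b * c + b * d + c * d = 0 := by
    linear_combination (1 / 2) * (a + b + c + d - e) * h1 - (1 / 2) * h2
  have hp : (a + e) * (b + e) * (c + e) * (d + e) = 0 := by
    field_simp at hi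
    linear_combination hi + e ^ 3 * h1 + e ^ 2 * hq
  simpa only [mul_eq_zero, or_assoc] using hp

lemma exists_add_eq_zero_of_three_two {a b c d e : ℂ} (ha : a ≠ 0) (hb : b ≠ 0) (hc : c ≠ 0)
    (hd : d ≠ 0) (he : e ≠ 0) (h1 : a + b + c + d + e = 0)
    (hi : a⁻¹ + b⁻¹ + c⁻¹ + d⁻¹ + e⁻¹ = 0) (h2 : a ^ 2 + b ^ 2 + c ^ 2 = d ^ 2 + e ^ 2)
    (hi2 : a⁻¹ ^ 2 + b⁻¹ ^ 2 + c⁻¹ ^ 2 = d⁻¹ ^ 2 + e⁻¹ ^ 2) :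
    a + b = 0 ∨ b + c = 0 ∨ c + a = 0 := by
  have key {a b c d e : ℂ} (h1 : a + b + c + d + e = 0)
      (h2 : a ^ 2 + b ^ 2 + c ^ 2 = d ^ 2 + e ^ 2) : a * b + b * c + c * a = d * e := by
    linear_combination (1 / 2) * (a + b + c - d - e) * h1 - (1 / 2) * h2
  have hq := key h1 h2
  have hqi := key hi hi2
  field_simp at hqi
  have hp : (a + b) * (b + c) * (c + a) = 0 := by
    linear_combination (a + b + c) * hq + hqi
  simpa only [mul_eq_zero, or_assoc] using hp

lemma IsMinVanishing.weight_five {P Q : Multiset ℂ} (hm : IsMinVanishing (P + Q))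
    (hcard : Multiset.card (P + Q) = 5) (hQ : Multiset.card Q ≤ 2)
    (hnorm : ∀ z ∈ P + Q, ‖z‖ = 1) (hsq : (P.map (· ^ 2)).sum = (Q.map (· ^ 2)).sum) :
    ∃ z ∈ P + Q,
      P + Q = ({z, z * nu 5, z * nu 5 ^ 2, z * nu 5 ^ 3, z * nu 5 ^ 4} : Multiset ℂ) := by
  have hs := hm.1
  have hi := sum_map_inv_eq_star hnorm
  rw [hs, map_zero] at hi
  have hi2 : (P.map fun z => z⁻¹ ^ 2).sum = (Q.map fun z => z⁻¹ ^ 2).sum := by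
    have hstar {R : Multiset ℂ} (hR : R ≤ P + Q) :
        (R.map fun z => z⁻¹ ^ 2).sum = starRingEnd ℂ (R.map (· ^ 2)).sum := by
      rw [← sum_map_inv_eq_star, Multiset.map_map]
      · simp
      · intro z hz
        obtain ⟨w, hw, rfl⟩ := Multiset.mem_map.1 hz
        rw [norm_pow, hnorm w (Multiset.mem_of_le hR hw), one_pow]
    rw [hstar (Multiset.le_add_right P Q), hstar (Multiset.le_add_left Q P), hsq]
  have ne {z : ℂ} (hz : z ∈ P + Q) : z ≠ 0 := by
    rintro rfl
    simpa using hnorm 0 hz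
  rw [Multiset.card_add] at hcard
  interval_cases hq : Multiset.card Q
  · obtain rfl := Multiset.card_eq_zero.1 hq
    rw [add_zero] at hs hnorm ⊢
    exact weight_five_of_sum_sq hs hnorm (by simpa using hsq) (by simpa using hcard)
  · exfalso
    obtain ⟨e, rfl⟩ := Multiset.card_eq_one.1 hq
    obtain ⟨a, b, c, d, rfl⟩ := Multiset.card_eq_four.1 (show Multiset.card P = 4 by omega)
    simp only [Multiset.insert_eq_cons, Multiset.map_cons, Multiset.sum_cons, Multiset.map_add,
      Multiset.sum_add, Multiset.map_singleton, Multiset.sum_singleton] at hs hi hsq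
    rcases exists_add_eq_zero_of_four_one (a := a) (b := b) (c := c) (d := d) (e := e)
      (ne (by simp)) (ne (by simp)) (ne (by simp))
      (ne (by simp)) (ne (by simp)) (by linear_combination hs) (by linear_combination hi)
      (by linear_combination hsq) with h | h | h | h
    · refine hm.add_ne_zero (t := {b, c, d}) ?_ (by simp) h
      simp only [Multiset.insert_eq_cons, ← Multiset.singleton_add]
      abel
    · refine hm.add_ne_zero (t := {a, c, d}) ?_ (by simp) h
      simp only [Multiset.insert_eq_cons, ← Multiset.singleton_add]
      abel
    · refine hm.add_ne_zero (t := {a, b, d}) ?_ (by simp) h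
      simp only [Multiset.insert_eq_cons, ← Multiset.singleton_add]
      abel
    · refine hm.add_ne_zero (t := {a, b, c}) ?_ (by simp) h
      simp only [Multiset.insert_eq_cons, ← Multiset.singleton_add]
      abel
  · exfalso
    obtain ⟨d, e, rfl⟩ := Multiset.card_eq_two.1 hq
    obtain ⟨a, b, c, rfl⟩ := Multiset.card_eq_three.1 (show Multiset.card P = 3 by omega)
    simp only [Multiset.insert_eq_cons, Multiset.map_cons, Multiset.sum_cons, Multiset.map_add,
      Multiset.sum_add, Multiset.map_singleton, Multiset.sum_singleton] at hs hi hsq hi2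
    rcases exists_add_eq_zero_of_three_two (a := a) (b := b) (c := c) (d := d) (e := e)
      (ne (by simp)) (ne (by simp)) (ne (by simp))
      (ne (by simp)) (ne (by simp)) (by linear_combination hs) (by linear_combination hi)
      (by linear_combination hsq) (by linear_combination hi2) with h | h | h
    · refine hm.add_ne_zero (t := {c, d, e}) ?_ (by simp) h
      simp only [Multiset.insert_eq_cons, ← Multiset.singleton_add]
      abel
    · refine hm.add_ne_zero (t := {a, d, e}) ?_ (by simp) h
      simp only [Multiset.insert_eq_cons, ← Multiset.singleton_add]
      abel
    · refine hm.add_ne_zero (t := {b, d, e}) ?_ (by simp) h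
      simp only [Multiset.insert_eq_cons, ← Multiset.singleton_add]
      abel

lemma sum_pow_add_two_eq {m : ℕ} (h : Multiset ℂ) (hh : ∀ z ∈ h, z ^ m = 1 ∨ z ^ m = -1) :
    (h.map (· ^ (m + 2))).sum = ((h.filter fun z => z ^ m = 1).map (· ^ 2)).sum
      - ((h.filter fun z => ¬ z ^ m = 1).map (· ^ 2)).sum := by
  induction h using Multiset.induction_on with
  | empty => simp
  | cons a s ih =>
    rw [Multiset.map_cons, Multiset.sum_cons,
      ih fun z hz => hh z (Multiset.mem_cons_of_mem hz)]
    rcases hh a (Multiset.mem_cons_self a s) with ha | ha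
    · rw [Multiset.filter_cons_of_pos (p := fun z => z ^ m = 1) _ ha,
        Multiset.filter_cons_of_neg (p := fun z => ¬ z ^ m = 1) _ (not_not.2 ha),
        Multiset.map_cons, Multiset.sum_cons, pow_add, ha]
      ring
    · have hne : ¬ a ^ m = 1 := by rw [ha]; norm_num
      rw [Multiset.filter_cons_of_neg (p := fun z => z ^ m = 1) _ hne,
        Multiset.filter_cons_of_pos (p := fun z => ¬ z ^ m = 1) _ hne,
        Multiset.map_cons, Multiset.sum_cons, pow_add, ha]
      ring

lemma IsMinVanishing.weight_five_of_one_mem {h : Multiset ℂ} (hm : IsMinVanishing h)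
    (h1 : (1 : ℂ) ∈ h) (hh : ∀ z ∈ h, IsRootOfUnity z) (hcard : Multiset.card h = 5) :
    ∃ z ∈ h, h = ({z, z * nu 5, z * nu 5 ^ 2, z * nu 5 ^ 3, z * nu 5 ^ 4} : Multiset ℂ) := by
  classical
  obtain ⟨n, hn, hpow⟩ := exists_common_exponent h hh
  obtain ⟨m, hodd, hpow⟩ := hm.exists_odd_exponent h1 n hn hpow
  have hcop : (m + 2).Coprime (2 * m) :=
    Nat.Coprime.mul_right (Nat.coprime_two_right.2 (hodd.add_even even_two))
      (by simpa using hodd)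
  have hs := sum_map_pow_eq_zero (by have := hodd.pos; omega) hcop hpow hm.1
  rw [sum_pow_add_two_eq h fun z hz => by
    rw [← sq_eq_one_iff, ← pow_mul, mul_comm, hpow z hz], sub_eq_zero] at hs
  have hadd := Multiset.filter_add_not (fun z : ℂ => z ^ m = 1) h
  generalize h.filter (fun z => z ^ m = 1) = P at hs hadd
  generalize h.filter (fun z => ¬ z ^ m = 1) = Q at hs hadd
  subst hadd
  have hnorm : ∀ z ∈ P + Q, ‖z‖ = 1 := fun z hz => (hh z hz).norm_eq_one_s12
  by_cases hQ : Multiset.card Q ≤ 2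
  · exact hm.weight_five hcard hQ hnorm hs
  · rw [add_comm P Q] at *
    rw [Multiset.card_add] at hcard
    exact hm.weight_five (by rwa [Multiset.card_add]) (by omega) hnorm hs.symm

theorem stmt_12 :
    (∀ h : Multiset ℂ, IsSorou h → IsMinVanishing h → Multiset.card h = 2 →
      ∃ z : ℂ, IsRootOfUnity z ∧ h = ({z, -z} : Multiset ℂ)) ∧
    (∀ h : Multiset ℂ, IsSorou h → IsMinVanishing h → Multiset.card h = 3 →
      ∃ z : ℂ, IsRootOfUnity z ∧
        h = ({z, z * nu 3, z * nu 3 ^ 2} : Multiset ℂ)) ∧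
    (∀ h : Multiset ℂ, IsSorou h → IsMinVanishing h → Multiset.card h = 5 →
      ∃ z : ℂ, IsRootOfUnity z ∧
        h = ({z, z * nu 5, z * nu 5 ^ 2, z * nu 5 ^ 3, z * nu 5 ^ 4} : Multiset ℂ)) := by
  refine ⟨fun h hh hm hcard => ?_, fun h hh hm hcard => ?_, fun h hh hm hcard => ?_⟩
  · obtain ⟨a, b, rfl⟩ := Multiset.card_eq_two.1 hcard
    have hs : a + b = 0 := by simpa using hm.1
    exact ⟨a, hh.2 a (by simp), by rw [eq_neg_of_add_eq_zero_right hs]⟩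
  · obtain ⟨z, hz, heq⟩ := weight_three hm.1 (fun z hz => (hh.2 z hz).norm_eq_one_s12) hcard
    exact ⟨z, hh.2 z hz, heq⟩
  · obtain ⟨a, ha⟩ := Multiset.exists_mem_of_ne_zero hh.1
    have ha0 : a ≠ 0 := by
      rintro rfl
      simpa using (hh.2 0 ha).norm_eq_one_s12
    have hroots : ∀ z ∈ h.map (a⁻¹ * ·), IsRootOfUnity z := by
      intro z hz
      obtain ⟨w, hw, rfl⟩ := Multiset.mem_map.1 hz
      exact (hh.2 a ha).inv.mul (hh.2 w hw)
    obtain ⟨z, hz, heq⟩ := (hm.map_mul (inv_ne_zero ha0)).weight_five_of_one_mem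
      (Multiset.mem_map.2 ⟨a, ha, inv_mul_cancel₀ ha0⟩) hroots (by simpa using hcard)
    refine ⟨a * z, (hh.2 a ha).mul (hroots z hz), ?_⟩
    have := congrArg (Multiset.map (a * ·)) heq
    simpa [Multiset.map_map, ha0, mul_assoc] using this
end
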